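/- arXiv:math/0608555 — 2 statements merged into one kernel-verified Lean document; each statement's English description precedes it below -/
import Mathlib

section
/- Fix purely imaginary parameters τ, τ' ∈ iℝ and set 𝒮 = 2(|τ| + |τ'|) + 1. Then there exists a constant C > 0, depending only on τ and τ', such that for every even integer n ≥ 0 and every λ = i·t with real t satisfying 𝒮 ≤ t < 4n, there is a complex number A(λ, n), independent of the test function, with |A(λ, n)| ≤ C · t^{−1/3}, such that for every smooth π-periodic function φ : ℝ → ℂ, |G_{λ,n}(φ) − A(λ, n) · φ(π/2)| ≤ C · ‖φ‖_{C²} · (1 + n)^{−1/2} + C · ‖φ‖_{C³} · t^{−3/2}. -/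
open MeasureTheory Real

/-- `pw r z = r^z = exp(z · ln r)` for a real base `r > 0`. -/
noncomputable def pw (r : ℝ) (z : ℂ) : ℂ := Complex.exp (z * (Real.log r : ℂ))

/-- The kernel `K_{τ,τ',λ}(x,y,z)` of the model trilinear functional. -/
noncomputable def Kker (τ τ' lam : ℂ) (x y z : ℝ) : ℂ :=
  pw |Real.sin (x - y)| ((-τ - τ' + lam - 1) / 2) *
    pw |Real.sin (x - z)| ((-τ + τ' - lam - 1) / 2) *
    pw |Real.sin (y - z)| ((τ - τ' - lam - 1) / 2)

/-- `l_λ(c) = (1/2π) ∫₀^{2π} K_{τ,τ',λ}(y+c, y, 0) dy`. -/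
noncomputable def lker (τ τ' lam : ℂ) (c : ℝ) : ℂ :=
  (1 / (2 * (π : ℂ))) * ∫ y in (0 : ℝ)..(2 * π), Kker τ τ' lam (y + c) y 0

/-- `F_{λ,n}(φ) = ∫₀^{2π} l_λ(c) e^{inc} φ(c) dc`. -/
noncomputable def Ffun (τ τ' lam : ℂ) (n : ℤ) (φ : ℝ → ℂ) : ℂ :=
  ∫ c in (0 : ℝ)..(2 * π),
    lker τ τ' lam c * Complex.exp (Complex.I * (n : ℂ) * (c : ℂ)) * φ c

/-- `k_λ(c) = |sin c|^{(-τ-τ'-1)/2} |sin(c/2)|^{-λ/2} |cos(c/2)|^{λ/2}`. -/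
noncomputable def kfun (τ τ' lam : ℂ) (c : ℝ) : ℂ :=
  pw |Real.sin c| ((-τ - τ' - 1) / 2) * pw |Real.sin (c / 2)| (-lam / 2) *
    pw |Real.cos (c / 2)| (lam / 2)

/-- `G_{λ,n}(φ) = 2 ∫₀^π k_λ(c) e^{inc} φ(c) dc`. -/
noncomputable def Gfun (τ τ' lam : ℂ) (n : ℤ) (φ : ℝ → ℂ) : ℂ :=
  2 * ∫ c in (0 : ℝ)..π,
    kfun τ τ' lam c * Complex.exp (Complex.I * (n : ℂ) * (c : ℂ)) * φ c

/-- Global `C^N`-norm of `φ`. -/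
noncomputable def Cnorm (N : ℕ) (φ : ℝ → ℂ) : ℝ :=
  ⨆ (m : Fin (N + 1)) (x : ℝ), ‖iteratedDeriv (m : ℕ) φ x‖

lemma abs_sin_sub_sin_ge {c b : ℝ} (hc : 0 ≤ c) (hc' : c ≤ π / 2) (hb : 0 ≤ b) (hb' : b ≤ π / 2) :
    1 / 5 * (|c - b| * (π - c - b)) ≤ |Real.sin c - Real.sin b| := by
  have hpi := Real.pi_pos
  have h1 : 2 / π * |(c - b) / 2| ≤ |Real.sin ((c - b) / 2)| :=
    Real.mul_abs_le_abs_sin (abs_le.2 ⟨by linarith, by linarith⟩)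
  have h2 : 2 / π * (π / 2 - (c + b) / 2) ≤ |Real.cos ((c + b) / 2)| := by
    rw [← Real.sin_pi_div_two_sub]
    exact (Real.mul_le_sin (by linarith) (by linarith)).trans (le_abs_self _)
  have h3 : (1 : ℝ) / 5 ≤ 2 / π ^ 2 := by
    rw [div_le_div_iff₀ (by norm_num) (by positivity)]
    nlinarith [Real.pi_lt_d2]
  rw [Real.sin_sub_sin, abs_mul, abs_mul, abs_two]
  have hy : 0 ≤ π - c - b := by linarith
  calc 1 / 5 * (|c - b| * (π - c - b)) ≤ 2 / π ^ 2 * (|c - b| * (π - c - b)) := by gcongr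
    _ = 2 * (2 / π * |(c - b) / 2|) * (2 / π * (π / 2 - (c + b) / 2)) := by
        rw [abs_div, abs_two]; field_simp; ring
    _ ≤ _ := by
        have : 0 ≤ π / 2 - (c + b) / 2 := by linarith
        gcongr

/-- The oscillating kernel `(sin c)^z · exp(ω (n c - (t/2) log tan (c/2)))` on `(0, π)`. -/
noncomputable def oscKernel (z ω : ℂ) (n t c : ℝ) : ℂ :=
  Complex.exp (z * (Real.log (Real.sin c) : ℂ) +
    ω * ((n * c - t / 2 * (Real.log (Real.sin (c / 2)) - Real.log (Real.cos (c / 2))) : ℝ) : ℂ))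

lemma hasDerivAt_oscKernel (z ω : ℂ) (n t : ℝ) {c : ℝ} (h0 : 0 < c) (h1 : c < π) :
    HasDerivAt (oscKernel z ω n t)
      (oscKernel z ω n t c * (z * ((Real.cos c / Real.sin c : ℝ) : ℂ) +
        ω * ((n - t / 2 * (1 / Real.sin c) : ℝ) : ℂ))) c := by
  have hs : 0 < Real.sin c := Real.sin_pos_of_pos_of_lt_pi h0 h1
  have hs2 : 0 < Real.sin (c / 2) := Real.sin_pos_of_pos_of_lt_pi (by linarith) (by linarith)
  have hc2 : 0 < Real.cos (c / 2) := Real.cos_pos_of_mem_Ioo ⟨by linarith, by linarith⟩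
  have hl := (Real.hasDerivAt_sin c).log hs.ne'
  have hhalf : HasDerivAt (fun x : ℝ => x / 2) (1 / 2) c := (hasDerivAt_id c).div_const 2
  have hls := (hhalf.sin).log hs2.ne'
  have hlc := (hhalf.cos).log hc2.ne'
  have hph := ((hasDerivAt_id c).const_mul n).sub ((hls.sub hlc).const_mul (t / 2))
  have hexp := ((hl.ofReal_comp.const_mul z).add (hph.ofReal_comp.const_mul ω)).cexp
  refine hexp.congr_deriv ?_
  have hsin : 1 / Real.sin c = Real.cos (c / 2) * (1 / 2) / Real.sin (c / 2) -
      -Real.sin (c / 2) * (1 / 2) / Real.cos (c / 2) := by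
    have : Real.sin c = 2 * Real.sin (c / 2) * Real.cos (c / 2) := by
      rw [← Real.sin_two_mul]; ring_nf
    rw [this]
    field_simp
    linarith [Real.sin_sq_add_cos_sq (c / 2)]
  rw [hsin, mul_one]
  rfl

lemma norm_oscKernel {z ω : ℂ} (hz : z.re = -(1 / 2)) (hω : ω.re = 0) (n t : ℝ) {c : ℝ}
    (h0 : 0 < c) (h1 : c < π) :
    ‖oscKernel z ω n t c‖ = (√(Real.sin c))⁻¹ := by
  have hs : 0 < Real.sin c := Real.sin_pos_of_pos_of_lt_pi h0 h1
  rw [oscKernel, Complex.norm_exp, Complex.add_re, Complex.re_mul_ofReal, Complex.re_mul_ofReal,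
    hz, hω, Real.sqrt_eq_rpow, ← Real.rpow_neg hs.le, Real.rpow_def_of_pos hs]
  ring_nf

lemma inv_sqrt_sin_le {c : ℝ} (h0 : 0 < c) (h1 : c ≤ π / 2) :
    (√(Real.sin c))⁻¹ ≤ 2 * (√c)⁻¹ := by
  have h : c / 4 ≤ Real.sin c := by
    refine le_trans ?_ (Real.mul_le_sin h0.le h1)
    have : (1 : ℝ) / 4 ≤ 2 / π := by
      rw [div_le_div_iff₀ (by norm_num) Real.pi_pos]; linarith [Real.pi_lt_d2]
    nlinarith
  have h2 : √c / 2 ≤ √(Real.sin c) := by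
    have : √(c / 4) = √c / 2 := by
      rw [Real.sqrt_div h0.le, show (4 : ℝ) = 2 ^ 2 by norm_num, Real.sqrt_sq (by norm_num)]
    rw [← this]; exact Real.sqrt_le_sqrt h
  have h3 : 0 < √c := Real.sqrt_pos.2 h0
  calc (√(Real.sin c))⁻¹ ≤ (√c / 2)⁻¹ := by gcongr
    _ = _ := by field_simp

/-- The derivative of `c ↦ c ^ (1/2) / (b - c)`, up to a factor `2`. -/
lemma hasDerivAt_two_sqrt_div_sub {b c : ℝ} (h0 : 0 < c) (hcb : c ≠ b) :
    HasDerivAt (fun x : ℝ => 2 * √x / (b - x)) ((c + b) / (√c * (c - b) ^ 2)) c := by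
  have hb : b - c ≠ 0 := sub_ne_zero.2 hcb.symm
  have hb' : c - b ≠ 0 := sub_ne_zero.2 hcb
  have hs : 0 < √c := Real.sqrt_pos.2 h0
  have h := ((Real.hasDerivAt_sqrt h0.ne').const_mul 2).div
    ((hasDerivAt_id c).const_sub b) hb
  refine h.congr_deriv ?_
  have hc : c = √c ^ 2 := (Real.sq_sqrt h0.le).symm
  simp only [id]
  rw [div_eq_div_iff (by positivity) (by positivity)]
  field_simp
  rw [Real.sq_sqrt h0.le]
  ring

/-- The hypotheses on the phase `n c - (t/2) log tan (c/2)` near its (almost) critical point `b`. -/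
structure PhaseData (n t b : ℝ) : Prop where
  n_pos : 0 < n
  t_pos : 0 < t
  b_pos : 0 < b
  b_le : b ≤ π / 2
  t_le : t ≤ 4 * n * b
  le_abs : ∀ s : ℝ, 0 ≤ s → s ≤ 1 → n * |s - Real.sin b| ≤ |n * s - t / 2|

namespace PhaseData

variable {n t b : ℝ}

lemma abs_le_compl (hP : PhaseData n t b) {c : ℝ} (h1 : c ≤ π / 2) : |c - b| ≤ π - c - b :=
  abs_le.2 ⟨by linarith [hP.b_le], by linarith [hP.b_le]⟩

lemma le_abs_phase (hP : PhaseData n t b) {c : ℝ} (h0 : 0 < c) (h1 : c ≤ π / 2) :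
    n / 5 * (|c - b| * (π - c - b)) ≤ |n * Real.sin c - t / 2| := by
  have h := abs_sin_sub_sin_ge h0.le h1 hP.b_pos.le hP.b_le
  have hs : 0 ≤ Real.sin c := Real.sin_nonneg_of_nonneg_of_le_pi h0.le (by linarith)
  have := hP.le_abs _ hs (Real.sin_le_one c)
  have hn := hP.n_pos
  calc n / 5 * (|c - b| * (π - c - b)) = n * (1 / 5 * (|c - b| * (π - c - b))) := by ring
    _ ≤ n * |Real.sin c - Real.sin b| := by gcongr
    _ ≤ _ := this

lemma phase_ne (hP : PhaseData n t b) {c : ℝ} (h0 : 0 < c) (h1 : c ≤ π / 2) (hcb : c ≠ b) :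
    n * Real.sin c - t / 2 ≠ 0 := by
  have hx : 0 < |c - b| := abs_pos.2 (sub_ne_zero.2 hcb)
  have hy := hP.abs_le_compl h1
  have hn := hP.n_pos
  refine abs_pos.1 (lt_of_lt_of_le ?_ (hP.le_abs_phase h0 h1))
  have : 0 < π - c - b := by linarith
  positivity

/-- Size of the boundary terms in the integration by parts. -/
lemma boundary_le (hP : PhaseData n t b) {c M H : ℝ} (h0 : 0 < c) (h1 : c ≤ π / 2)
    (hcb : c ≠ b) (hM : 0 ≤ M) (hH : H ≤ M * (π - c - b)) :
    (√(Real.sin c))⁻¹ * H * |Real.sin c / (n * Real.sin c - t / 2)| ≤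
      5 * (M / n) * (√c / |c - b|) := by
  have hx : 0 < |c - b| := abs_pos.2 (sub_ne_zero.2 hcb)
  have hy : 0 < π - c - b := by linarith [hP.abs_le_compl h1]
  have hn := hP.n_pos
  have hs : 0 < Real.sin c := Real.sin_pos_of_pos_of_lt_pi h0 (by linarith)
  have hD := hP.le_abs_phase h0 h1
  rw [abs_div, abs_of_pos hs]
  have hss : (√(Real.sin c))⁻¹ * Real.sin c = √(Real.sin c) := by
    nth_rewrite 2 [← Real.mul_self_sqrt hs.le]
    have : 0 < √(Real.sin c) := Real.sqrt_pos.2 hs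
    field_simp
  calc (√(Real.sin c))⁻¹ * H * (Real.sin c / |n * Real.sin c - t / 2|)
      ≤ (√(Real.sin c))⁻¹ * (M * (π - c - b)) *
          (Real.sin c / (n / 5 * (|c - b| * (π - c - b)))) := by gcongr
    _ = ((√(Real.sin c))⁻¹ * Real.sin c) * (5 * (M / n) / |c - b|) := by field_simp
    _ = √(Real.sin c) * (5 * (M / n) / |c - b|) := by rw [hss]
    _ ≤ √c * (5 * (M / n) / |c - b|) := by
        gcongr
        exact Real.sin_le h0.le
    _ = _ := by ring

/-- Size of the integrand remaining after the integration by parts. -/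
lemma remainder_le (hP : PhaseData n t b) {c M H H' Z : ℝ} (h0 : 0 < c) (h1 : c ≤ π / 2)
    (hcb : c ≠ b) (hM : 0 ≤ M) (hH0 : 0 ≤ H) (hH : H ≤ M * (π - c - b)) (hH' : H' ≤ M)
    (hZ : 0 ≤ Z) :
    (√(Real.sin c))⁻¹ * (H' * |Real.sin c / (n * Real.sin c - t / 2)| +
        Z * (Real.cos c / Real.sin c) * H * |Real.sin c / (n * Real.sin c - t / 2)| +
        H * (t / 2 * Real.cos c / (n * Real.sin c - t / 2) ^ 2)) ≤
      (105 + 10 * Z) * (M / n) * ((c + b) / (√c * (c - b) ^ 2)) := by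
  have hx : 0 < |c - b| := abs_pos.2 (sub_ne_zero.2 hcb)
  have hxy := hP.abs_le_compl h1
  have hy : 0 < π - c - b := by linarith
  have hn := hP.n_pos
  have hb := hP.b_pos
  have ht := hP.t_pos
  have hs : 0 < Real.sin c := Real.sin_pos_of_pos_of_lt_pi h0 (by linarith)
  have hcos0 : 0 ≤ Real.cos c := Real.cos_nonneg_of_mem_Icc ⟨by linarith, h1⟩
  have hcosy : Real.cos c ≤ π - c - b := by
    rw [← Real.sin_pi_div_two_sub]
    exact (Real.sin_le (by linarith)).trans (by linarith [hP.b_le])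
  have hD := hP.le_abs_phase h0 h1
  have hxb : |c - b| ≤ c + b := abs_le.2 ⟨by linarith, by linarith⟩
  have hinv := inv_sqrt_sin_le h0 h1
  have hsc : 0 < √c := Real.sqrt_pos.2 h0
  have e2 : (c - b) ^ 2 = |c - b| ^ 2 := (sq_abs _).symm
  have T1 : (√(Real.sin c))⁻¹ * H' * |Real.sin c / (n * Real.sin c - t / 2)| ≤
      5 * (M / n) * ((c + b) / (√c * (c - b) ^ 2)) := by
    have hH1 : H' ≤ M / |c - b| * (π - c - b) := by
      rw [div_mul_eq_mul_div, le_div_iff₀ hx]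
      nlinarith
    refine (hP.boundary_le h0 h1 hcb (by positivity) hH1).trans ?_
    have : √c ≤ (c + b) / √c := by
      rw [le_div_iff₀ hsc, Real.mul_self_sqrt h0.le]; linarith
    calc 5 * (M / |c - b| / n) * (√c / |c - b|)
        = 5 * (M / n) * (√c / |c - b| ^ 2) := by field_simp
      _ ≤ 5 * (M / n) * ((c + b) / √c / |c - b| ^ 2) := by gcongr
      _ = _ := by rw [e2]; field_simp
  have T2 : (√(Real.sin c))⁻¹ * (Z * (Real.cos c / Real.sin c) * H *
      |Real.sin c / (n * Real.sin c - t / 2)|) ≤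
      10 * Z * (M / n) * ((c + b) / (√c * (c - b) ^ 2)) := by
    rw [abs_div, abs_of_pos hs]
    calc (√(Real.sin c))⁻¹ * (Z * (Real.cos c / Real.sin c) * H *
          (Real.sin c / |n * Real.sin c - t / 2|))
        ≤ (2 * (√c)⁻¹) * (Z * (1 / Real.sin c) * (M * (π - c - b)) *
          (Real.sin c / (n / 5 * (|c - b| * (π - c - b))))) := by
          gcongr
          exact Real.cos_le_one c
      _ = 10 * Z * (M / n) * (|c - b| / (√c * (c - b) ^ 2)) := by
          rw [e2]; field_simp; ring
      _ ≤ _ := by gcongr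
  have T3 : (√(Real.sin c))⁻¹ * (H * (t / 2 * Real.cos c / (n * Real.sin c - t / 2) ^ 2)) ≤
      100 * (M / n) * ((c + b) / (√c * (c - b) ^ 2)) := by
    rw [← sq_abs (n * Real.sin c - t / 2)]
    calc (√(Real.sin c))⁻¹ * (H * (t / 2 * Real.cos c / |n * Real.sin c - t / 2| ^ 2))
        ≤ (2 * (√c)⁻¹) * ((M * (π - c - b)) * ((4 * n * b) / 2 * (π - c - b) /
          (n / 5 * (|c - b| * (π - c - b))) ^ 2)) := by
          gcongr
          exact hP.t_le
      _ = 100 * (M / n) * (b / (√c * (c - b) ^ 2)) := by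
          rw [e2]; field_simp; ring
      _ ≤ _ := by
          gcongr
          linarith
  linarith

end PhaseData

lemma continuousOn_oscKernel (z ω : ℂ) (n t : ℝ) :
    ContinuousOn (oscKernel z ω n t) (Set.Ioo 0 π) := fun _ hc =>
  (hasDerivAt_oscKernel z ω n t hc.1 hc.2).continuousAt.continuousWithinAt

/-- First derivative test on an interval away from the critical point. -/
lemma PhaseData.norm_integral_le {n t b : ℝ} (hP : PhaseData n t b) {z ω : ℂ}
    (hz : z.re = -(1 / 2)) (hω : ω.re = 0) (hω1 : ‖ω‖ = 1) {a d M : ℝ} {h h' : ℝ → ℂ}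
    (ha : 0 < a) (had : a ≤ d) (hd : d ≤ π / 2) (hb : ∀ c ∈ Set.Icc a d, c ≠ b) (hM : 0 ≤ M)
    (hh : ∀ c, HasDerivAt h (h' c) c) (hh' : ∀ c, ‖h' c‖ ≤ M)
    (hhM : ∀ c ∈ Set.Icc a d, ‖h c‖ ≤ M * (π - c - b)) :
    ‖∫ c in a..d, oscKernel z ω n t c * h c‖ ≤
      5 * (M / n) * (√a / |a - b| + √d / |d - b|) +
        (105 + 10 * ‖z‖) * (M / n) * (2 * √d / (b - d) - 2 * √a / (b - a)) := by
  have hpi := Real.pi_pos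
  have hω0 : ω ≠ 0 := by
    rintro rfl
    simp at hω1
  set f : ℝ → ℂ := fun c => oscKernel z ω n t c * h c with hf
  set q : ℝ → ℝ := fun c => Real.sin c / (n * Real.sin c - t / 2) with hq
  set B : ℝ → ℂ := fun c => oscKernel z ω n t c * h c * (q c : ℂ) / ω with hB
  set q' : ℝ → ℝ := fun c => -(t / 2 * Real.cos c / (n * Real.sin c - t / 2) ^ 2) with hq'
  have hpos : ∀ c ∈ Set.Icc a d, 0 < c ∧ c ≤ π / 2 ∧ c < π := fun c hc =>
    ⟨ha.trans_le hc.1, hc.2.trans hd, by linarith [hc.2]⟩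
  have hfc : ContinuousOn f (Set.Ioo 0 π) := (continuousOn_oscKernel z ω n t).mul
    fun c _ => (hh c).continuousAt.continuousWithinAt
  have hfI : ∀ c ∈ Set.Icc a d, IntervalIntegrable f volume a c := fun c hc => by
    refine (hfc.mono ?_).intervalIntegrable
    rw [Set.uIcc_of_le hc.1]
    exact fun x hx => ⟨ha.trans_le hx.1, by linarith [hx.2, hc.2]⟩
  have hqd : ∀ c ∈ Set.Icc a d, HasDerivAt q (q' c) c := fun c hc => by
    obtain ⟨h0, h1, -⟩ := hpos c hc
    have hne := hP.phase_ne h0 h1 (hb c hc)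
    refine ((Real.hasDerivAt_sin c).div (((Real.hasDerivAt_sin c).const_mul n).sub_const _)
      hne).congr_deriv ?_
    simp only [hq', neg_div']
    congr 1
    ring
  set R : ℝ → ℂ := fun c => oscKernel z ω n t c / ω * (h' c * (q c : ℂ) +
    z * ((Real.cos c / Real.sin c : ℝ) : ℂ) * h c * (q c : ℂ) + h c * (q' c : ℂ)) with hR
  have hBd : ∀ c ∈ Set.Icc a d, HasDerivAt B (f c + R c) c := fun c hc => by
    obtain ⟨h0, h1, h2⟩ := hpos c hc
    have hne := hP.phase_ne h0 h1 (hb c hc)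
    have hs : 0 < Real.sin c := Real.sin_pos_of_pos_of_lt_pi h0 h2
    refine ((((hasDerivAt_oscKernel z ω n t h0 h2).mul (hh c)).mul
      (hqd c hc).ofReal_comp).div_const ω).congr_deriv ?_
    have hqq : ((n - t / 2 * (1 / Real.sin c) : ℝ) : ℂ) * (q c : ℂ) = 1 := by
      rw [← Complex.ofReal_mul, ← Complex.ofReal_one]
      congr 1
      simp only [hq]
      rw [show n - t / 2 * (1 / Real.sin c) = (n * Real.sin c - t / 2) / Real.sin c by field_simp]
      rw [div_mul_div_comm, mul_comm, div_self (mul_ne_zero hs.ne' hne)]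
    simp only [hf, hR, Pi.mul_apply]
    generalize ((n - t / 2 * (1 / Real.sin c) : ℝ) : ℂ) = w at hqq ⊢
    generalize ((Real.cos c / Real.sin c : ℝ) : ℂ) = v
    field_simp
    linear_combination oscKernel z ω n t c * h c * ω * hqq
  have hderiv : ∀ c ∈ Set.Icc a d,
      HasDerivAt (fun x => (∫ y in a..x, f y) - (B x - B a)) (-R c) c := fun c hc => by
    obtain ⟨h0, h1, h2⟩ := hpos c hc
    refine ((intervalIntegral.integral_hasDerivAt_right (hfI c hc)
      (hfc.stronglyMeasurableAtFilter isOpen_Ioo c ⟨h0, h2⟩)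
      (hfc.continuousAt (isOpen_Ioo.mem_nhds ⟨h0, h2⟩))).sub
        ((hBd c hc).sub_const (B a))).congr_deriv ?_
    ring
  set P : ℝ → ℝ := fun x => 2 * √x / (b - x) with hPdef
  set K : ℝ := (105 + 10 * ‖z‖) * (M / n) with hK
  have hPd : ∀ c ∈ Set.Icc a d, HasDerivAt (fun x => K * (P x - P a))
      (K * ((c + b) / (√c * (c - b) ^ 2))) c := fun c hc =>
    ((hasDerivAt_two_sqrt_div_sub (hpos c hc).1 (hb c hc)).sub_const (P a)).const_mul K
  have hmain := image_norm_le_of_norm_deriv_right_le_deriv_boundary'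
    (f := fun x => (∫ y in a..x, f y) - (B x - B a)) (f' := fun c => -R c)
    (B := fun x => K * (P x - P a)) (B' := fun c => K * ((c + b) / (√c * (c - b) ^ 2)))
    (fun c hc => (hderiv c hc).continuousAt.continuousWithinAt)
    (fun c hc => (hderiv c (Set.Ico_subset_Icc_self hc)).hasDerivWithinAt)
    (by simp)
    (fun c hc => (hPd c hc).continuousAt.continuousWithinAt)
    (fun c hc => (hPd c (Set.Ico_subset_Icc_self hc)).hasDerivWithinAt)
    (fun c hc' => by
      have hc := Set.Ico_subset_Icc_self hc'
      obtain ⟨h0, h1, h2⟩ := hpos c hc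
      have hcos0 : 0 ≤ Real.cos c := Real.cos_nonneg_of_mem_Icc ⟨by linarith, h1⟩
      have hs : 0 < Real.sin c := Real.sin_pos_of_pos_of_lt_pi h0 h2
      refine le_trans ?_ (hP.remainder_le h0 h1 (hb c hc) hM (norm_nonneg (h c)) (hhM c hc)
        (hh' c) (norm_nonneg z))
      rw [norm_neg, hR, norm_mul, norm_div, hω1, div_one, norm_oscKernel hz hω n t h0 h2]
      gcongr
      refine (norm_add₃_le).trans (le_of_eq ?_)
      have hq'0 : |q' c| = t / 2 * Real.cos c / (n * Real.sin c - t / 2) ^ 2 := by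
        have := hP.t_pos
        rw [hq', abs_neg, abs_of_nonneg (by positivity)]
      have hcot : |Real.cos c / Real.sin c| = Real.cos c / Real.sin c :=
        abs_of_nonneg (by positivity)
      rw [norm_mul, norm_mul, norm_mul, norm_mul, norm_mul, Complex.norm_real, Complex.norm_real,
        Complex.norm_real, Real.norm_eq_abs, Real.norm_eq_abs, Real.norm_eq_abs, hq'0, hcot])
    (Set.right_mem_Icc.2 had)
  have hBle : ∀ c ∈ Set.Icc a d, ‖B c‖ ≤ 5 * (M / n) * (√c / |c - b|) := fun c hc => by
    obtain ⟨h0, h1, h2⟩ := hpos c hc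
    refine le_trans (le_of_eq ?_) (hP.boundary_le h0 h1 (hb c hc) hM (hhM c hc))
    rw [hB, norm_div, hω1, div_one, norm_mul, norm_mul, norm_oscKernel hz hω n t h0 h2,
      Complex.norm_real, Real.norm_eq_abs]
  have h1 := hBle a (Set.left_mem_Icc.2 had)
  have h2 := hBle d (Set.right_mem_Icc.2 had)
  calc ‖∫ c in a..d, f c‖ = ‖((∫ c in a..d, f c) - (B d - B a)) + (B d - B a)‖ := by
        rw [sub_add_cancel]
    _ ≤ K * (P d - P a) + (‖B d‖ + ‖B a‖) := norm_add_le_of_le hmain (norm_sub_le _ _)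
    _ ≤ _ := by linarith

lemma measurable_oscKernel (z ω : ℂ) (n t : ℝ) : Measurable (oscKernel z ω n t) := by
  unfold oscKernel
  fun_prop

lemma norm_oscKernel_le {z ω : ℂ} (hz : z.re = -(1 / 2)) (hω : ω.re = 0) (n t : ℝ) {c : ℝ}
    (h0 : 0 < c) (h1 : c ≤ π / 2) : ‖oscKernel z ω n t c‖ ≤ 2 * (√c)⁻¹ :=
  (norm_oscKernel hz hω n t h0 (by linarith)).trans_le (inv_sqrt_sin_le h0 h1)

lemma intervalIntegrable_oscKernel_mul {z ω : ℂ} (hz : z.re = -(1 / 2)) (hω : ω.re = 0) (n t : ℝ)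
    {h : ℝ → ℂ} (hh : Continuous h) {N : ℝ} (hN : ∀ c, ‖h c‖ ≤ N) :
    IntervalIntegrable (fun c => oscKernel z ω n t c * h c) volume 0 (π / 2) := by
  have hN0 : 0 ≤ N := (norm_nonneg _).trans (hN 0)
  refine IntervalIntegrable.mono_fun
    ((intervalIntegral.intervalIntegrable_rpow' (r := -(1 / 2)) (by norm_num)).const_mul (2 * N))
    ((measurable_oscKernel z ω n t).mul hh.measurable).aestronglyMeasurable ?_
  refine (ae_restrict_mem measurableSet_uIoc).mono fun c hc => ?_
  rw [Set.uIoc_of_le (by positivity)] at hc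
  have hr : c ^ (-(1 / 2) : ℝ) = (√c)⁻¹ := by rw [Real.rpow_neg hc.1.le, Real.sqrt_eq_rpow]
  dsimp only
  rw [norm_mul, hr, Real.norm_of_nonneg (by positivity)]
  calc ‖oscKernel z ω n t c‖ * ‖h c‖ ≤ (2 * (√c)⁻¹) * N := by
        gcongr
        exacts [norm_oscKernel_le hz hω n t hc.1 hc.2, hN c]
    _ = _ := by ring

/-- Estimate of the integral over `(0, π/2)`, where the interval of radius `δ` around the critical
point is estimated trivially and the first derivative test is applied on the rest. -/
lemma PhaseData.norm_integral_half_le {n t b : ℝ} (hP : PhaseData n t b) {z ω : ℂ}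
    (hz : z.re = -(1 / 2)) (hω : ω.re = 0) (hω1 : ‖ω‖ = 1) {δ N M : ℝ} {h h' : ℝ → ℂ}
    (hδ : 0 < δ) (hδb : δ ≤ b / 2)
    (hh : ∀ c, HasDerivAt h (h' c) c) (hh' : ∀ c, ‖h' c‖ ≤ M) (hN : ∀ c, ‖h c‖ ≤ N)
    (hhM : ∀ c, 0 < c → c ≤ π / 2 → δ ≤ |c - b| → ‖h c‖ ≤ M * (π - c - b)) :
    ‖∫ c in (0 : ℝ)..(π / 2), oscKernel z ω n t c * h c‖ ≤
      (700 + 60 * ‖z‖) * (N * δ / √b + M * √b / (n * δ)) := by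
  have hpi := Real.pi_pos
  have hb := hP.b_pos
  have hble := hP.b_le
  have hn := hP.n_pos
  have hN0 : 0 ≤ N := (norm_nonneg _).trans (hN 0)
  have hM : 0 ≤ M := (norm_nonneg _).trans (hh' 0)
  have hsb : 0 < √b := Real.sqrt_pos.2 hb
  set f : ℝ → ℂ := fun c => oscKernel z ω n t c * h c with hf
  have hfI : IntervalIntegrable f volume 0 (π / 2) :=
    intervalIntegrable_oscKernel_mul hz hω n t
      (continuous_iff_continuousAt.2 fun c => (hh c).continuousAt) hN
  set X := M * √b / (n * δ) with hX
  set Y := N * δ / √b with hY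
  have hX0 : 0 ≤ X := by positivity
  have hY0 : 0 ≤ Y := by positivity
  have hz0 : 0 ≤ ‖z‖ := norm_nonneg z
  have hsub : ∀ {x y : ℝ}, 0 ≤ x → x ≤ π / 2 → 0 ≤ y → y ≤ π / 2 →
      IntervalIntegrable f volume x y := fun hx hx' hy hy' =>
    hfI.mono_set (Set.uIcc_subset_uIcc (by rw [Set.uIcc_of_le (by positivity)]; exact ⟨hx, hx'⟩)
      (by rw [Set.uIcc_of_le (by positivity)]; exact ⟨hy, hy'⟩))
  have hleft' : ∀ a ∈ Set.Ioc 0 (b - δ), ‖∫ c in a..(b - δ), f c‖ ≤ (220 + 20 * ‖z‖) * X := by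
    intro a ha
    have key := hP.norm_integral_le hz hω hω1 ha.1 ha.2 (by linarith)
      (fun c hc => by linarith [hc.2]) hM hh hh' (fun c hc => hhM c (ha.1.trans_le hc.1)
        (by linarith [hc.2]) (by rw [abs_sub_comm, abs_of_nonneg] <;> linarith [hc.2]))
    have hab : |a - b| = b - a := by
      rw [abs_sub_comm, abs_of_nonneg]; linarith [ha.2]
    have hdb : |b - δ - b| = δ := by
      rw [abs_sub_comm, abs_of_nonneg] <;> linarith
    have hba : δ ≤ b - a := by linarith [ha.2]
    have hba0 : 0 < b - a := by linarith
    rw [hab, hdb, sub_sub_cancel] at key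
    have e1 : √a / (b - a) ≤ √b / δ := by
      gcongr
      linarith [ha.2]
    have e2 : √(b - δ) / δ ≤ √b / δ := by
      gcongr
      linarith
    have e3 : 0 ≤ 2 * √a / (b - a) := by positivity
    have e4 : 2 * √(b - δ) / δ = 2 * (√(b - δ) / δ) := by ring
    calc _ ≤ _ := key
      _ ≤ 5 * (M / n) * (√b / δ + √b / δ) + (105 + 10 * ‖z‖) * (M / n) * (2 * (√b / δ)) := by
          gcongr
          linarith
      _ = _ := by rw [hX]; field_simp; ring
  have hleft : ‖∫ c in (0 : ℝ)..(b - δ), f c‖ ≤ (220 + 20 * ‖z‖) * X := by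
    have hI : IntervalIntegrable f volume 0 (b - δ) :=
      hsub le_rfl (by positivity) (by linarith) (by linarith)
    have hI' : IntegrableOn f (Set.uIcc 0 (b - δ)) := by
      rw [Set.uIcc_of_le (by linarith)]
      exact (intervalIntegrable_iff_integrableOn_Icc_of_le (by linarith)).1 hI
    have hcont := intervalIntegral.continuousOn_primitive_interval_left hI'
    rw [Set.uIcc_of_le (by linarith)] at hcont
    have htend := ((hcont 0 ⟨le_rfl, by linarith⟩).mono (Set.Ioc_subset_Icc_self)).norm
    have : (nhdsWithin 0 (Set.Ioc 0 (b - δ))).NeBot := by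
      rw [← mem_closure_iff_nhdsWithin_neBot, closure_Ioc (by linarith)]
      exact ⟨le_rfl, by linarith⟩
    exact le_of_tendsto htend (Filter.mem_of_superset self_mem_nhdsWithin hleft')
  set e := min (b + δ) (π / 2) with he
  have heb : b ≤ e := le_min (by linarith) hble
  have hepi : e ≤ π / 2 := min_le_right _ _
  have hmid : ‖∫ c in (b - δ)..e, f c‖ ≤ 8 * Y := by
    have hbd : ∀ c ∈ Set.uIoc (b - δ) e, ‖f c‖ ≤ 4 / √b * N := by
      intro c hc
      rw [Set.uIoc_of_le (by linarith)] at hc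
      have hcpos : b / 4 ≤ c := by linarith [hc.1]
      have hsq : √b / 2 ≤ √c := by
        have : √(b / 4) = √b / 2 := by
          rw [Real.sqrt_div hb.le, show (4 : ℝ) = 2 ^ 2 by norm_num, Real.sqrt_sq (by norm_num)]
        rw [← this]; exact Real.sqrt_le_sqrt hcpos
      rw [hf, norm_mul]
      calc ‖oscKernel z ω n t c‖ * ‖h c‖ ≤ (2 * (√c)⁻¹) * N := by
            gcongr
            exacts [norm_oscKernel_le hz hω n t (by linarith) (hc.2.trans hepi), hN c]
        _ ≤ (2 * (√b / 2)⁻¹) * N := by gcongr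
        _ = _ := by field_simp; ring
    refine (intervalIntegral.norm_integral_le_of_norm_le_const hbd).trans ?_
    have : |e - (b - δ)| ≤ 2 * δ := by
      rw [abs_of_nonneg (by linarith)]
      linarith [min_le_left (b + δ) (π / 2)]
    calc 4 / √b * N * |e - (b - δ)| ≤ 4 / √b * N * (2 * δ) := by gcongr
      _ = _ := by rw [hY]; ring
  have hright : ‖∫ c in e..(π / 2), f c‖ ≤ (440 + 40 * ‖z‖) * X := by
    rcases le_total (π / 2) (b + δ) with hle | hle
    · rw [he, min_eq_right hle, intervalIntegral.integral_same, norm_zero]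
      positivity
    · rw [he, min_eq_left hle]
      have key := hP.norm_integral_le hz hω hω1 (a := b + δ) (by linarith) hle le_rfl
        (fun c hc => by linarith [hc.1]) hM hh hh' (fun c hc => hhM c (by linarith [hc.1])
          hc.2 (by rw [abs_of_nonneg] <;> linarith [hc.1]))
      have hpb : 0 < π / 2 - b := by linarith
      have h1 : |b + δ - b| = δ := by rw [abs_of_nonneg] <;> linarith
      have h2 : |π / 2 - b| = π / 2 - b := abs_of_pos hpb
      have h3 : b - (b + δ) = -δ := by ring
      have h4 : b - π / 2 = -(π / 2 - b) := by ring
      rw [h1, h2, h3, h4, div_neg, div_neg] at key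
      have e1 : √(b + δ) / δ ≤ 2 * (√b / δ) := by
        have : √(b + δ) ≤ 2 * √b := by
          rw [Real.sqrt_le_left (by positivity), mul_pow, Real.sq_sqrt hb.le]
          linarith
        rw [← mul_div_assoc]
        gcongr
      have e2 : √(π / 2) / (π / 2 - b) ≤ √(b + δ) / δ := by
        rw [div_le_div_iff₀ hpb hδ]
        have hu : √(π / 2) ^ 2 = π / 2 := Real.sq_sqrt (by positivity)
        have hv : √(b + δ) ^ 2 = b + δ := Real.sq_sqrt (by positivity)
        have huv : √(b + δ) ≤ √(π / 2) := Real.sqrt_le_sqrt hle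
        have hprod : 0 ≤ √(b + δ) * √(π / 2) := by positivity
        have hd : δ = √(b + δ) ^ 2 - b := by rw [hv]; ring
        generalize √(π / 2) = u at *
        rw [← hu]
        generalize √(b + δ) = v at *
        rw [hd]
        nlinarith [mul_nonneg (sub_nonneg.2 huv) hprod, mul_nonneg (sub_nonneg.2 huv) hb.le]
      have e3 : 0 ≤ √(π / 2) / (π / 2 - b) := by positivity
      have e4 : 2 * √(π / 2) / (π / 2 - b) = 2 * (√(π / 2) / (π / 2 - b)) := by ring
      have e5 : 2 * √(b + δ) / δ = 2 * (√(b + δ) / δ) := by ring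
      calc _ ≤ _ := key
        _ ≤ 5 * (M / n) * (2 * (√b / δ) + 2 * (√b / δ)) +
            (105 + 10 * ‖z‖) * (M / n) * (4 * (√b / δ)) := by
            gcongr
            · exact e2.trans e1
            · linarith
        _ = _ := by rw [hX]; field_simp; ring
  have hsplit : ∫ c in (0 : ℝ)..(π / 2), f c =
      (∫ c in (0 : ℝ)..(b - δ), f c) + (∫ c in (b - δ)..e, f c) + ∫ c in e..(π / 2), f c := by
    rw [intervalIntegral.integral_add_adjacent_intervals
        (hsub le_rfl (by positivity) (by linarith) (by linarith))
        (hsub (by linarith) (by linarith) (by linarith) hepi),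
      intervalIntegral.integral_add_adjacent_intervals
        (hsub le_rfl (by positivity) (by linarith) hepi)
        (hsub (by linarith) hepi (by positivity) le_rfl)]
  rw [hsplit]
  refine norm_add₃_le.trans ?_
  have : 0 ≤ ‖z‖ * Y := by positivity
  nlinarith

lemma oscKernel_pi_sub (z : ℂ) (n t c : ℝ) :
    oscKernel z Complex.I n t (π - c) =
      Complex.exp (Complex.I * ((n * π : ℝ) : ℂ)) * oscKernel z (-Complex.I) n t c := by
  have h : (π - c) / 2 = π / 2 - c / 2 := by ring
  rw [oscKernel, oscKernel, Real.sin_pi_sub, h, Real.sin_pi_div_two_sub, Real.cos_pi_div_two_sub,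
    ← Complex.exp_add]
  congr 1
  push_cast
  ring

section Gfun

variable {τ τ' : ℂ}

lemma re_exponent (hτ : τ.re = 0) (hτ' : τ'.re = 0) : ((-τ - τ' - 1) / 2).re = -(1 / 2) := by
  have : ((-τ - τ' - 1) / 2 : ℂ) = (-τ - τ' - 1) / ((2 : ℝ) : ℂ) := by norm_num
  rw [this, Complex.div_ofReal_re]
  simp [hτ, hτ']
  norm_num

lemma Gfun_eq (n : ℤ) (t : ℝ) (φ : ℝ → ℂ) :
    Gfun τ τ' (Complex.I * (t : ℂ)) n φ =
      2 * ∫ c in (0 : ℝ)..π, oscKernel ((-τ - τ' - 1) / 2) Complex.I n t c * φ c := by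
  rw [Gfun]
  congr 2
  ext c
  rw [kfun, pw, pw, pw, Real.log_abs, Real.log_abs, Real.log_abs, oscKernel, ← Complex.exp_add,
    ← Complex.exp_add, ← Complex.exp_add]
  congr 2
  push_cast
  ring

lemma intervalIntegrable_oscKernel_right (hτ : τ.re = 0) (hτ' : τ'.re = 0) (n t : ℝ) {h : ℝ → ℂ}
    (hh : Continuous h) {N : ℝ} (hN : ∀ c, ‖h c‖ ≤ N) :
    IntervalIntegrable (fun c => oscKernel ((-τ - τ' - 1) / 2) Complex.I n t c * h c) volume
      (π / 2) π := by
  have h1 := (intervalIntegrable_oscKernel_mul (ω := -Complex.I) (re_exponent hτ hτ') (by simp)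
    n t (h := fun c => h (π - c)) (by fun_prop) (fun c => hN (π - c))).const_mul
      (Complex.exp (Complex.I * ((n * π : ℝ) : ℂ)))
  have h2 := (h1.comp_sub_left π).symm
  rw [sub_zero, show π - π / 2 = π / 2 by ring] at h2
  refine h2.congr fun c _ => ?_
  have := oscKernel_pi_sub ((-τ - τ' - 1) / 2) n t (π - c)
  rw [sub_sub_cancel] at this
  simp only [sub_sub_cancel]
  rw [this, mul_assoc]

lemma intervalIntegrable_oscKernel_left (hτ : τ.re = 0) (hτ' : τ'.re = 0) (n t : ℝ) {h : ℝ → ℂ}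
    (hh : Continuous h) {N : ℝ} (hN : ∀ c, ‖h c‖ ≤ N) :
    IntervalIntegrable (fun c => oscKernel ((-τ - τ' - 1) / 2) Complex.I n t c * h c) volume
      0 (π / 2) :=
  intervalIntegrable_oscKernel_mul (re_exponent hτ hτ') (by simp) n t hh hN

lemma Gfun_sub_mul (hτ : τ.re = 0) (hτ' : τ'.re = 0) (n : ℤ) (t : ℝ) {φ : ℝ → ℂ}
    (hφ : Continuous φ) {N : ℝ} (hN : ∀ c, ‖φ c‖ ≤ N) (w : ℂ) :
    Gfun τ τ' (Complex.I * (t : ℂ)) n φ - Gfun τ τ' (Complex.I * (t : ℂ)) n (fun _ => 1) * w =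
      Gfun τ τ' (Complex.I * (t : ℂ)) n (fun c => φ c - w) := by
  have h1 := (intervalIntegrable_oscKernel_left hτ hτ' n t hφ hN).trans
    (intervalIntegrable_oscKernel_right hτ hτ' n t hφ hN)
  have h2 := (intervalIntegrable_oscKernel_left hτ hτ' n t (h := fun _ => 1) (by fun_prop)
    (N := 1) (by simp)).trans (intervalIntegrable_oscKernel_right hτ hτ' n t (h := fun _ => 1)
    (by fun_prop) (N := 1) (by simp))
  simp only [mul_one] at h2
  simp only [Gfun_eq, mul_sub, mul_one]
  rw [intervalIntegral.integral_sub h1 (h2.mul_const w), intervalIntegral.integral_mul_const]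
  ring

/-- Combination of the estimates on `(0, π/2)` and, after reflection, `(π/2, π)`. -/
lemma PhaseData.norm_Gfun_le (hτ : τ.re = 0) (hτ' : τ'.re = 0) {n : ℤ} {t b : ℝ}
    (hP : PhaseData n t b) {δ N M : ℝ} {h h' : ℝ → ℂ} (hδ : 0 < δ) (hδb : δ ≤ b / 2)
    (hh : ∀ c, HasDerivAt h (h' c) c) (hh' : ∀ c, ‖h' c‖ ≤ M) (hN : ∀ c, ‖h c‖ ≤ N)
    (hhM : ∀ c, 0 < c → c ≤ π / 2 → δ ≤ |c - b| →
      ‖h c‖ ≤ M * (π - c - b) ∧ ‖h (π - c)‖ ≤ M * (π - c - b)) :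
    ‖Gfun τ τ' (Complex.I * (t : ℂ)) n h‖ ≤
      4 * (700 + 60 * ‖(-τ - τ' - 1) / 2‖) * (N * δ / √b + M * √b / (n * δ)) := by
  have hcont : Continuous h := continuous_iff_continuousAt.2 fun c => (hh c).continuousAt
  have hz := re_exponent hτ hτ'
  have h1 := hP.norm_integral_half_le (ω := Complex.I) hz (by simp) (by simp) hδ hδb hh hh' hN
    (fun c h0 h1 h2 => (hhM c h0 h1 h2).1)
  have h2 := hP.norm_integral_half_le (ω := -Complex.I) hz (by simp) (by simp) hδ hδb
    (h := fun c => h (π - c)) (h' := fun c => -h' (π - c))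
    (fun c => (hh (π - c)).comp_const_sub π c)
    (fun c => by rw [norm_neg]; exact hh' _) (fun c => hN _)
    (fun c h0 h1 h2 => (hhM c h0 h1 h2).2)
  have hrefl : ∫ c in (π / 2)..π, oscKernel ((-τ - τ' - 1) / 2) Complex.I n t c * h c =
      Complex.exp (Complex.I * (((n : ℝ) * π : ℝ) : ℂ)) * ∫ c in (0 : ℝ)..(π / 2),
        oscKernel ((-τ - τ' - 1) / 2) (-Complex.I) n t c * h (π - c) := by
    have := intervalIntegral.integral_comp_sub_left
      (fun c => oscKernel ((-τ - τ' - 1) / 2) Complex.I n t c * h c) π (a := 0) (b := π / 2)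
    rw [sub_zero, show π - π / 2 = π / 2 by ring] at this
    rw [← this, ← intervalIntegral.integral_const_mul]
    simp only [oscKernel_pi_sub, mul_assoc]
  have hexp : ‖Complex.exp (Complex.I * (((n : ℝ) * π : ℝ) : ℂ))‖ = 1 := by
    rw [mul_comm, Complex.norm_exp_ofReal_mul_I]
  rw [Gfun_eq, ← intervalIntegral.integral_add_adjacent_intervals
    (intervalIntegrable_oscKernel_left hτ hτ' n t hcont hN)
    (intervalIntegrable_oscKernel_right hτ hτ' n t hcont hN), hrefl, norm_mul, Complex.norm_two]
  have h3 := norm_add_le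
    (∫ c in (0 : ℝ)..(π / 2), oscKernel ((-τ - τ' - 1) / 2) Complex.I n t c * h c)
    (Complex.exp (Complex.I * (((n : ℝ) * π : ℝ) : ℂ)) * ∫ c in (0 : ℝ)..(π / 2),
        oscKernel ((-τ - τ' - 1) / 2) (-Complex.I) n t c * h (π - c))
  rw [norm_mul, hexp, one_mul] at h3
  linarith

end Gfun

/-- The critical point of the phase, or `π / 2` if there is none. -/
lemma exists_phaseData {n t : ℝ} (ht : 0 < t) (htn : t < 4 * n) : ∃ b, PhaseData n t b := by
  have hn : 0 < n := by linarith
  have hr : 0 < t / (2 * n) := by positivity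
  set w := min 1 (t / (2 * n)) with hw
  have hw0 : 0 < w := lt_min one_pos hr
  have hw1 : w ≤ 1 := min_le_left _ _
  have hsin : Real.sin (Real.arcsin w) = w := Real.sin_arcsin (by linarith) hw1
  have hb : 0 < Real.arcsin w := Real.arcsin_pos.2 hw0
  refine ⟨Real.arcsin w, hn, ht, hb, Real.arcsin_le_pi_div_two w, ?_, fun s hs0 hs1 => ?_⟩
  · have h1 : w ≤ Real.arcsin w := hsin.symm.le.trans (Real.sin_le hb.le)
    have h2 : t / (4 * n) ≤ w := by
      refine le_min ?_ ?_
      · rw [div_le_one (by positivity)]; exact htn.le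
      · gcongr; norm_num
    rw [div_le_iff₀ (by positivity)] at h2
    nlinarith
  · rw [hsin, ← abs_of_pos hn, ← abs_mul, abs_of_pos hn]
    rcases le_total (t / (2 * n)) 1 with h | h
    · rw [hw, min_eq_right h]
      apply le_of_eq
      congr 1
      field_simp
    · rw [hw, min_eq_left h]
      rw [le_div_iff₀ (by positivity)] at h
      rw [abs_of_nonpos (by nlinarith), abs_of_nonpos (by nlinarith)]
      nlinarith

lemma Cnorm_nonneg (N : ℕ) (φ : ℝ → ℂ) : 0 ≤ Cnorm N φ :=
  Real.iSup_nonneg fun _ => Real.iSup_nonneg fun _ => norm_nonneg _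

lemma norm_iteratedDeriv_le_Cnorm {N m : ℕ} (hm : m ≤ N) {φ : ℝ → ℂ}
    (hφ : ContDiff ℝ (⊤ : ℕ∞) φ) {p : ℝ} (hp : p ≠ 0) (hper : ∀ x, φ (x + p) = φ x) (x : ℝ) :
    ‖iteratedDeriv m φ x‖ ≤ Cnorm N φ := by
  have hc : Continuous (iteratedDeriv m φ) :=
    hφ.continuous_iteratedDeriv m (by exact_mod_cast le_top)
  have hP : Function.Periodic (iteratedDeriv m φ) p := fun y => by
    have := congrFun (iteratedDeriv_comp_add_const m φ p) y
    rw [funext hper] at this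
    exact this.symm
  obtain ⟨K, hK⟩ := (hP.isBounded_of_continuous hp hc).exists_norm_le
  have hbdd : BddAbove (Set.range fun y => ‖iteratedDeriv m φ y‖) :=
    ⟨K, by rintro _ ⟨y, rfl⟩; exact hK _ ⟨y, rfl⟩⟩
  refine (le_ciSup hbdd x).trans ?_
  exact le_ciSup (f := fun m : Fin (N + 1) => ⨆ y, ‖iteratedDeriv (m : ℕ) φ y‖)
    (Set.finite_range _).bddAbove ⟨m, by omega⟩

lemma PhaseData.norm_Gfun_one_le {τ τ' : ℂ} (hτ : τ.re = 0) (hτ' : τ'.re = 0) {n : ℤ}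
    {t b : ℝ} (hP : PhaseData n t b) (ht : 1 ≤ t) (htn : t < 4 * n) (hn1 : (1 : ℝ) ≤ n)
    (hδb : √(b / n) / 4 ≤ b / 2) :
    ‖Gfun τ τ' (Complex.I * (t : ℂ)) n (fun _ => 1)‖ ≤
      100 * (700 + 60 * ‖(-τ - τ' - 1) / 2‖) * t ^ (-(1 / 3) : ℝ) := by
  have hb := hP.b_pos
  have hn := hP.n_pos
  have hsb : 0 < √b := Real.sqrt_pos.2 hb
  have hsn : 0 < √(n : ℝ) := Real.sqrt_pos.2 hn
  have hC : 0 ≤ 700 + 60 * ‖(-τ - τ' - 1) / 2‖ := by positivity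
  have ht0 : 0 < t := hP.t_pos
  have hT : (n : ℝ) ^ (-(1 / 3) : ℝ) ≤ 2 * t ^ (-(1 / 3) : ℝ) := by
    have h1 : (n : ℝ) ^ (-(1 / 3) : ℝ) ≤ (t / 4) ^ (-(1 / 3) : ℝ) :=
      Real.rpow_le_rpow_of_nonpos (by positivity) (by linarith) (by norm_num)
    have h2 : (4 : ℝ)⁻¹ ^ (-(1 / 3) : ℝ) ≤ 2 := by
      rw [Real.inv_rpow (by norm_num), Real.rpow_neg (by norm_num), inv_inv,
        show (4 : ℝ) = 2 ^ (2 : ℝ) by norm_num, ← Real.rpow_mul (by norm_num)]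
      exact (Real.rpow_le_rpow_of_exponent_le (by norm_num) (by norm_num)).trans
        (Real.rpow_one 2).le
    rw [show t / 4 = 4⁻¹ * t by ring, Real.mul_rpow (by norm_num) ht0.le] at h1
    exact h1.trans (by gcongr)
  rcases le_or_gt b 1 with hb1 | hb1
  · have key := hP.norm_Gfun_le hτ hτ' (h := fun _ => 1) (h' := fun _ => 0) (N := 1) (M := 2)
      (δ := √(b / n) / 4) (by positivity) hδb (fun c => hasDerivAt_const c 1) (by simp) (by simp)
      (fun c h0 h1 _ => by
        rw [norm_one]
        constructor <;> linarith [Real.pi_gt_three])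
    have hn3 : (√(n : ℝ))⁻¹ ≤ (n : ℝ) ^ (-(1 / 3) : ℝ) := by
      rw [Real.sqrt_eq_rpow, ← Real.rpow_neg hn.le]
      exact Real.rpow_le_rpow_of_exponent_le hn1 (by norm_num)
    have e : 1 * (√(b / n) / 4) / √b + 2 * √b / (n * (√(b / n) / 4)) =
        (8 + 1 / 4) * (√(n : ℝ))⁻¹ := by
      rw [Real.sqrt_div hb.le]
      nth_rewrite 2 [← Real.mul_self_sqrt hn.le]
      field_simp
      ring
    rw [e] at key
    refine key.trans ?_
    calc 4 * (700 + 60 * ‖(-τ - τ' - 1) / 2‖) * ((8 + 1 / 4) * (√(n : ℝ))⁻¹)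
        ≤ 4 * (700 + 60 * ‖(-τ - τ' - 1) / 2‖) * ((8 + 1 / 4) * (2 * t ^ (-(1 / 3) : ℝ))) := by
          gcongr
          exact hn3.trans hT
      _ = 66 * (700 + 60 * ‖(-τ - τ' - 1) / 2‖) * t ^ (-(1 / 3) : ℝ) := by ring
      _ ≤ _ := by gcongr; norm_num
  · set r := (n : ℝ) ^ (-(1 / 3) : ℝ) with hr
    have hr0 : 0 < r := Real.rpow_pos_of_pos hn _
    have hr1 : r ≤ 1 := Real.rpow_le_one_of_one_le_of_nonpos hn1 (by norm_num)
    have hr3 : (n : ℝ) * r ^ 3 = 1 := by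
      rw [hr, ← Real.rpow_natCast, ← Real.rpow_mul hn.le]
      norm_num
      rw [Real.rpow_neg_one, mul_inv_cancel₀ hn.ne']
    have key := hP.norm_Gfun_le hτ hτ' (h := fun _ => 1) (h' := fun _ => 0) (N := 1)
      (M := (r / 2)⁻¹) (δ := r / 2) (by positivity) (by linarith)
      (fun c => hasDerivAt_const c 1) (by simp; positivity) (by simp)
      (fun c h0 h1 h2 => by
        have h3 := hP.abs_le_compl h1
        have : 1 ≤ (r / 2)⁻¹ * (π - c - b) := by
          rw [inv_mul_eq_div, le_div_iff₀ (by positivity)]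
          linarith
        rw [norm_one]
        exact ⟨this, this⟩)
    have e1 : 1 * (r / 2) / √b ≤ r / 2 := by
      rw [one_mul]
      exact div_le_self (by positivity) (Real.one_le_sqrt.2 hb1.le)
    have e2 : (r / 2)⁻¹ * √b / (n * (r / 2)) ≤ 8 * r := by
      have hb2 : √b ≤ 2 := by
        rw [Real.sqrt_le_left (by norm_num)]
        linarith [hP.b_le, Real.pi_lt_d2]
      calc (r / 2)⁻¹ * √b / (n * (r / 2)) ≤ (r / 2)⁻¹ * 2 / (n * (r / 2)) := by gcongr
        _ = 8 * r / (n * r ^ 3) := by field_simp; norm_num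
        _ = 8 * r := by rw [hr3, div_one]
    refine key.trans ?_
    calc _ ≤ 4 * (700 + 60 * ‖(-τ - τ' - 1) / 2‖) * (r / 2 + 8 * r) := by gcongr
      _ = 34 * (700 + 60 * ‖(-τ - τ' - 1) / 2‖) * r := by ring
      _ ≤ 34 * (700 + 60 * ‖(-τ - τ' - 1) / 2‖) * (2 * t ^ (-(1 / 3) : ℝ)) := by gcongr
      _ = 68 * (700 + 60 * ‖(-τ - τ' - 1) / 2‖) * t ^ (-(1 / 3) : ℝ) := by ring
      _ ≤ _ := by gcongr; norm_num

lemma PhaseData.norm_Gfun_sub_le {τ τ' : ℂ} (hτ : τ.re = 0) (hτ' : τ'.re = 0) {n : ℤ}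
    {t b : ℝ} (hP : PhaseData n t b) (hn1 : (1 : ℝ) ≤ n) (hδb : √(b / n) / 4 ≤ b / 2)
    {φ φ' : ℝ → ℂ} {K : ℝ} (hφ : ∀ c, HasDerivAt φ (φ' c) c) (hK : ∀ c, ‖φ c‖ ≤ K)
    (hK' : ∀ c, ‖φ' c‖ ≤ K) :
    ‖Gfun τ τ' (Complex.I * (t : ℂ)) n φ -
        Gfun τ τ' (Complex.I * (t : ℂ)) n (fun _ => 1) * φ (π / 2)‖ ≤
      100 * (700 + 60 * ‖(-τ - τ' - 1) / 2‖) * K * (1 + (n : ℝ)) ^ (-(1 / 2) : ℝ) := by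
  have hb := hP.b_pos
  have hn := hP.n_pos
  have hsb : 0 < √b := Real.sqrt_pos.2 hb
  have hsn : 0 < √(n : ℝ) := Real.sqrt_pos.2 hn
  have hK0 : 0 ≤ K := (norm_nonneg _).trans (hK 0)
  have hC : 0 ≤ 700 + 60 * ‖(-τ - τ' - 1) / 2‖ := by positivity
  have hlip : ∀ x y, ‖φ x - φ y‖ ≤ K * ‖x - y‖ := fun x y =>
    convex_univ.norm_image_sub_le_of_norm_hasDerivWithin_le
      (fun c _ => (hφ c).hasDerivWithinAt) (fun c _ => hK' c) (Set.mem_univ y) (Set.mem_univ x)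
  rw [Gfun_sub_mul hτ hτ' n t (continuous_iff_continuousAt.2 fun c => (hφ c).continuousAt) hK]
  have key := hP.norm_Gfun_le hτ hτ' (h := fun c => φ c - φ (π / 2)) (h' := φ') (N := 2 * K)
      (M := K) (δ := √(b / n) / 4) (by positivity) hδb (fun c => (hφ c).sub_const _) hK'
      (fun c => (norm_sub_le _ _).trans (by linarith [hK c, hK (π / 2)]))
      (fun c h0 h1 _ => by
        have hbl := hP.b_le
        refine ⟨(hlip c (π / 2)).trans ?_, (hlip (π - c) (π / 2)).trans ?_⟩
        · gcongr
          rw [Real.norm_eq_abs, abs_of_nonpos (by linarith)]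
          linarith
        · gcongr
          rw [Real.norm_eq_abs, abs_of_nonneg (by linarith)]
          linarith)
  have e : 2 * K * (√(b / n) / 4) / √b + K * √b / (n * (√(b / n) / 4)) =
      (4 + 1 / 2) * K * (√(n : ℝ))⁻¹ := by
    rw [Real.sqrt_div hb.le]
    nth_rewrite 2 [← Real.mul_self_sqrt hn.le]
    field_simp
    ring
  have hr : (√(n : ℝ))⁻¹ ≤ 2 * (1 + (n : ℝ)) ^ (-(1 / 2) : ℝ) := by
    rw [Real.rpow_neg (by positivity), ← Real.sqrt_eq_rpow, ← div_eq_mul_inv,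
      inv_eq_one_div, div_le_div_iff₀ hsn (by positivity), one_mul,
      Real.sqrt_le_left (by positivity), mul_pow, Real.sq_sqrt hn.le]
    linarith
  rw [e] at key
  refine key.trans ?_
  calc 4 * (700 + 60 * ‖(-τ - τ' - 1) / 2‖) * ((4 + 1 / 2) * K * (√(n : ℝ))⁻¹)
      ≤ 4 * (700 + 60 * ‖(-τ - τ' - 1) / 2‖) *
          ((4 + 1 / 2) * K * (2 * (1 + (n : ℝ)) ^ (-(1 / 2) : ℝ))) := by gcongr
    _ = 36 * (700 + 60 * ‖(-τ - τ' - 1) / 2‖) * K * (1 + (n : ℝ)) ^ (-(1 / 2) : ℝ) := by ring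
    _ ≤ _ := by gcongr; norm_num

/-- For `𝒮 ≤ t < 4n` there is `A(λ,n)` with `|A(λ,n)| ≤ C t^{-1/3}` such that
`|G_{it,n}(φ) - A(λ,n) φ(π/2)| ≤ C ‖φ‖_{C²} (1+n)^{-1/2} + C ‖φ‖_{C³} t^{-3/2}`. -/
theorem stmt_13 (τ τ' : ℂ) (hτ : τ.re = 0) (hτ' : τ'.re = 0) :
    ∃ C : ℝ, 0 < C ∧
      ∀ n : ℤ, 0 ≤ n → Even n →
        ∀ t : ℝ, 2 * (‖τ‖ + ‖τ'‖) + 1 ≤ t → t < 4 * (n : ℝ) →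
          ∃ A : ℂ, ‖A‖ ≤ C * t ^ (-(1 / 3) : ℝ) ∧
            ∀ φ : ℝ → ℂ, ContDiff ℝ (⊤ : ℕ∞) φ → (∀ x : ℝ, φ (x + π) = φ x) →
              ‖Gfun τ τ' (Complex.I * (t : ℂ)) n φ - A * φ (π / 2)‖ ≤
                C * Cnorm 2 φ * (1 + (n : ℝ)) ^ (-(1 / 2) : ℝ) +
                  C * Cnorm 3 φ * t ^ (-(3 / 2) : ℝ) := by
  refine ⟨100 * (700 + 60 * ‖(-τ - τ' - 1) / 2‖), by positivity, fun n _ _ t ht htn => ?_⟩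
  have ht1 : 1 ≤ t := by linarith [norm_nonneg τ, norm_nonneg τ']
  have hn0 : (0 : ℝ) < n := by linarith
  have hn1 : (1 : ℝ) ≤ n := by exact_mod_cast Int.cast_pos.1 hn0
  obtain ⟨b, hP⟩ := exists_phaseData (n := n) (by linarith) htn
  have hb := hP.b_pos
  have hδb : √(b / n) / 4 ≤ b / 2 := by
    have : √(b / n) ≤ 2 * b := by
      rw [Real.sqrt_le_left (by positivity), div_le_iff₀ hn0]
      nlinarith [hP.t_le]
    linarith
  refine ⟨Gfun τ τ' (Complex.I * (t : ℂ)) n (fun _ => 1),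
    hP.norm_Gfun_one_le hτ hτ' ht1 htn hn1 hδb, fun φ hφ hper => ?_⟩
  have hd : ∀ c, HasDerivAt φ (deriv φ c) c := fun c =>
    (hφ.differentiable (by simp) c).hasDerivAt
  have h0 : ∀ c, ‖φ c‖ ≤ Cnorm 2 φ := fun c => by
    simpa using norm_iteratedDeriv_le_Cnorm (N := 2) (m := 0) (by norm_num) hφ Real.pi_ne_zero
      hper c
  have h1 : ∀ c, ‖deriv φ c‖ ≤ Cnorm 2 φ := fun c => by
    simpa using norm_iteratedDeriv_le_Cnorm (N := 2) (m := 1) (by norm_num) hφ Real.pi_ne_zero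
      hper c
  refine (hP.norm_Gfun_sub_le hτ hτ' hn1 hδb hd h0 h1).trans (le_add_of_nonneg_right ?_)
  have := Cnorm_nonneg 3 φ
  positivity
end

section
/- Fix purely imaginary parameters τ, τ' ∈ iℝ, set 𝒮 = 2(|τ| + |τ'|) + 1, and fix η > 0. Then there exist a constant C' > 0 and, for every N > 0, a constant C'_N > 0 (all depending only on τ, τ', η and N) such that the following holds for every even integer n ≥ 0, every λ = i·t with real t ≥ 𝒮, and every smooth π-periodic function φ : ℝ → ℂ that vanishes on {c ∈ [0, π] : |c − π/2| < η}: writing δ = 2n/t, one has |G_{λ,n}(φ)| ≤ C' · ‖φ‖_{C²} · t^{−1/2} if δ > 0.9, and |G_{λ,n}(φ)| ≤ C'_N · ‖φ‖_{C^N} · t^{−N} if 0 ≤ δ ≤ 0.9. -/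
open MeasureTheory Real

noncomputable def gd (u : ℝ) : ℝ := 2 * Real.arctan (Real.exp u)

noncomputable def sechPow (α : ℂ) (u : ℝ) : ℂ :=
  Complex.exp (-α * (Real.log (Real.cosh u) : ℂ))

noncomputable def osc (s δ u : ℝ) : ℂ :=
  Complex.exp (Complex.I * ((s * (δ * gd u - u) : ℝ) : ℂ))

theorem one_add_exp_sq (u : ℝ) : 1 + Real.exp u ^ 2 = 2 * Real.exp u * Real.cosh u := by
  rw [Real.cosh_eq, Real.exp_neg]
  field_simp
  ring

theorem hasDerivAt_gd (u : ℝ) : HasDerivAt gd (Real.cosh u)⁻¹ u := by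
  have h := ((Real.hasDerivAt_exp u).arctan).const_mul 2
  refine h.congr_deriv ?_
  rw [one_add_exp_sq]
  have := Real.cosh_pos u
  field_simp

theorem continuous_gd : Continuous gd :=
  continuous_iff_continuousAt.2 fun u => (hasDerivAt_gd u).continuousAt

theorem hasDerivAt_tanh (u : ℝ) : HasDerivAt Real.tanh ((Real.cosh u)⁻¹ ^ 2) u := by
  have h : Real.tanh = fun x => Real.sinh x / Real.cosh x :=
    funext Real.tanh_eq_sinh_div_cosh
  rw [h]
  have hc := (Real.cosh_pos u).ne'
  refine ((Real.hasDerivAt_sinh u).div (Real.hasDerivAt_cosh u) hc).congr_deriv ?_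
  have := Real.cosh_sq u
  field_simp
  linarith

theorem continuous_tanh : Continuous Real.tanh :=
  continuous_iff_continuousAt.2 fun u => (hasDerivAt_tanh u).continuousAt

theorem hasDerivAt_inv_cosh (u : ℝ) :
    HasDerivAt (fun x => (Real.cosh x)⁻¹) (-((Real.cosh u)⁻¹ * Real.tanh u)) u := by
  have hc := (Real.cosh_pos u).ne'
  refine ((Real.hasDerivAt_cosh u).inv hc).congr_deriv ?_
  rw [Real.tanh_eq_sinh_div_cosh]
  field_simp

theorem continuous_inv_cosh : Continuous fun x => (Real.cosh x)⁻¹ :=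
  Real.continuous_cosh.inv₀ fun x => (Real.cosh_pos x).ne'

theorem inv_cosh_pos (u : ℝ) : 0 < (Real.cosh u)⁻¹ := inv_pos.2 (Real.cosh_pos u)

theorem inv_cosh_le_one (u : ℝ) : (Real.cosh u)⁻¹ ≤ 1 := inv_le_one_of_one_le₀ (Real.one_le_cosh u)

theorem hasDerivAt_sechPow (α : ℂ) (u : ℝ) :
    HasDerivAt (sechPow α) (-α * (Real.tanh u : ℂ) * sechPow α u) u := by
  have hc := (Real.cosh_pos u).ne'
  have h := (((Real.hasDerivAt_cosh u).log hc).ofReal_comp.const_mul (-α)).cexp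
  refine h.congr_deriv ?_
  rw [Real.tanh_eq_sinh_div_cosh]
  simp only [sechPow]
  ring

theorem continuous_sechPow (α : ℂ) : Continuous (sechPow α) :=
  continuous_iff_continuousAt.2 fun u => (hasDerivAt_sechPow α u).continuousAt

theorem hasDerivAt_osc (s δ u : ℝ) :
    HasDerivAt (osc s δ)
      (Complex.I * (s : ℂ) * ((δ * (Real.cosh u)⁻¹ - 1 : ℝ) : ℂ) * osc s δ u) u := by
  have h := (((((hasDerivAt_gd u).const_mul δ).sub (hasDerivAt_id u)).const_mul
    s).ofReal_comp.const_mul Complex.I).cexp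
  refine h.congr_deriv ?_
  simp only [osc, id, Pi.sub_apply, Complex.ofReal_mul, Complex.ofReal_sub]
  push_cast
  ring

theorem continuous_osc (s δ : ℝ) : Continuous (osc s δ) :=
  continuous_iff_continuousAt.2 fun u => (hasDerivAt_osc s δ u).continuousAt

theorem norm_osc (s δ u : ℝ) : ‖osc s δ u‖ = 1 := by
  rw [osc, mul_comm, Complex.norm_exp_ofReal_mul_I]

theorem norm_sechPow {α : ℂ} (hα : α.re = 1 / 2) (u : ℝ) :
    ‖sechPow α u‖ = Real.exp (-(1 / 2) * Real.log (Real.cosh u)) := by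
  rw [sechPow, Complex.norm_exp]
  simp [hα]

theorem norm_sechPow_le_one {α : ℂ} (hα : α.re = 1 / 2) (u : ℝ) : ‖sechPow α u‖ ≤ 1 := by
  rw [norm_sechPow hα]
  have := Real.log_nonneg (Real.one_le_cosh u)
  exact Real.exp_le_one_iff.2 (by linarith)

theorem inv_cosh_le_norm_sechPow {α : ℂ} (hα : α.re = 1 / 2) (u : ℝ) :
    (Real.cosh u)⁻¹ ≤ ‖sechPow α u‖ := by
  rw [norm_sechPow hα, ← Real.exp_log (inv_cosh_pos u), Real.log_inv]
  have := Real.log_nonneg (Real.one_le_cosh u)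
  exact Real.exp_le_exp.2 (by linarith)

theorem exp_abs_le_two_mul_cosh (u : ℝ) : Real.exp |u| ≤ 2 * Real.cosh u := by
  rw [← Real.cosh_abs u, Real.cosh_eq]
  have := Real.exp_pos (-|u|)
  linarith

theorem integrable_norm_sechPow {α : ℂ} (hα : α.re = 1 / 2) :
    Integrable fun u => ‖sechPow α u‖ := by
  have h1 : IntegrableOn (fun u : ℝ => Real.exp (-(1 / 2) * |u|)) (Set.Ioi 0) := by
    refine (integrableOn_exp_mul_Ioi (a := -(1 / 2)) (by norm_num) 0).congr_fun ?_
      measurableSet_Ioi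
    intro u hu
    simp only [abs_of_pos (Set.mem_Ioi.1 hu)]
  have h2 : IntegrableOn (fun u : ℝ => Real.exp (-(1 / 2) * |u|)) (Set.Iic 0) := by
    refine (integrableOn_exp_mul_Iic (a := 1 / 2) (by norm_num) 0).congr_fun ?_
      measurableSet_Iic
    intro u hu
    simp only [abs_of_nonpos (Set.mem_Iic.1 hu)]
    ring_nf
  have h3 : Integrable (fun u : ℝ => Real.exp (-(1 / 2) * |u|)) := by
    rw [← integrableOn_univ, ← Set.Iic_union_Ioi (a := (0 : ℝ))]
    exact h2.union h1
  refine (h3.const_mul (Real.exp (1 / 2 * Real.log 2))).mono'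
    (continuous_sechPow α).norm.aestronglyMeasurable (Filter.Eventually.of_forall fun u => ?_)
  rw [norm_norm, norm_sechPow hα, ← Real.exp_add]
  have h := Real.log_le_log (Real.exp_pos _) (exp_abs_le_two_mul_cosh u)
  rw [Real.log_exp, Real.log_mul two_ne_zero (Real.cosh_pos u).ne'] at h
  exact Real.exp_le_exp.2 (by linarith)

theorem integrable_of_norm_le_sechPow {E : Type*} [NormedAddCommGroup E] {α : ℂ}
    (hα : α.re = 1 / 2) {f : ℝ → E} [SecondCountableTopologyEither ℝ E] (hf : Continuous f)
    (C : ℝ) (h : ∀ u, ‖f u‖ ≤ C * ‖sechPow α u‖) : Integrable f :=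
  ((integrable_norm_sechPow hα).const_mul C).mono' hf.aestronglyMeasurable
    (Filter.Eventually.of_forall h)

theorem iteratedDeriv_norm_le_Cnorm {φ : ℝ → ℂ} (hφ : ContDiff ℝ (⊤ : ℕ∞) φ)
    (hper : ∀ x, φ (x + π) = φ x) {m N : ℕ} (hm : m ≤ N) (x : ℝ) :
    ‖iteratedDeriv m φ x‖ ≤ Cnorm N φ := by
  have hp : ∀ m : ℕ, Function.Periodic (iteratedDeriv m φ) π := by
    intro m y
    have h : (fun z => φ (z + π)) = φ := funext hper
    have h2 := congrFun (iteratedDeriv_comp_add_const m φ π) y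
    rw [h] at h2
    exact h2.symm
  have hb : ∀ m : ℕ, BddAbove (Set.range fun y => ‖iteratedDeriv m φ y‖) := by
    intro m
    have hc : Continuous fun y => ‖iteratedDeriv m φ y‖ :=
      (hφ.continuous_iteratedDeriv m (by exact_mod_cast le_top)).norm
    have hq : Function.Periodic (fun y => ‖iteratedDeriv m φ y‖) π := fun y => by
      simp only [hp m y]
    exact (hq.compact_of_continuous Real.pi_ne_zero hc).bddAbove
  have h1 : ‖iteratedDeriv m φ x‖ ≤ ⨆ y, ‖iteratedDeriv m φ y‖ := le_ciSup (hb m) x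
  refine h1.trans ?_
  exact le_ciSup (f := fun k : Fin (N + 1) => ⨆ y, ‖iteratedDeriv (k : ℕ) φ y‖)
    (Set.finite_range _).bddAbove ⟨m, Nat.lt_succ_of_le hm⟩

/-- Coefficients occurring in repeated integration by parts against `osc s δ`: the algebra
generated by `δ`, `tanh`, `sech` and the inverse of the phase derivative `δ sech u - 1`. -/
inductive IsCoeff : (ℝ → ℝ → ℂ) → Prop
  | const (z : ℂ) : IsCoeff fun _ _ => z
  | param : IsCoeff fun δ _ => (δ : ℂ)
  | tanh : IsCoeff fun _ u => (Real.tanh u : ℂ)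
  | sech : IsCoeff fun _ u => ((Real.cosh u)⁻¹ : ℝ)
  | inv : IsCoeff fun δ u => ((δ * (Real.cosh u)⁻¹ - 1 : ℝ)⁻¹ : ℝ)
  | add {P Q : ℝ → ℝ → ℂ} : IsCoeff P → IsCoeff Q → IsCoeff fun δ u => P δ u + Q δ u
  | mul {P Q : ℝ → ℝ → ℂ} : IsCoeff P → IsCoeff Q → IsCoeff fun δ u => P δ u * Q δ u

theorem phase_deriv_le {δ : ℝ} (hδ : δ ∈ Set.Icc (0 : ℝ) 0.9) (u : ℝ) :
    δ * (Real.cosh u)⁻¹ - 1 ≤ -(1 / 10) := by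
  have h := mul_le_mul hδ.2 (inv_cosh_le_one u) (inv_cosh_pos u).le (by norm_num)
  norm_num at h ⊢
  linarith

theorem IsCoeff.bounded {P : ℝ → ℝ → ℂ} (hP : IsCoeff P) :
    ∃ C : ℝ, 0 ≤ C ∧ ∀ δ ∈ Set.Icc (0 : ℝ) 0.9, ∀ u, ‖P δ u‖ ≤ C := by
  induction hP with
  | const z => exact ⟨‖z‖, norm_nonneg z, fun _ _ _ => le_rfl⟩
  | param =>
    refine ⟨0.9, by norm_num, fun δ hδ _ => ?_⟩
    rw [Complex.norm_real, Real.norm_of_nonneg hδ.1]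
    exact hδ.2
  | tanh =>
    refine ⟨1, by norm_num, fun δ _ u => ?_⟩
    rw [Complex.norm_real]
    exact (Real.abs_tanh_lt_one u).le
  | sech =>
    refine ⟨1, by norm_num, fun δ _ u => ?_⟩
    rw [Complex.norm_real, Real.norm_of_nonneg (inv_cosh_pos u).le]
    exact inv_cosh_le_one u
  | inv =>
    refine ⟨10, by norm_num, fun δ hδ u => ?_⟩
    have h := phase_deriv_le hδ u
    rw [Complex.norm_real, norm_inv, Real.norm_of_nonpos (by linarith)]
    exact inv_le_of_inv_le₀ (by norm_num) (by linarith)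
  | add _ _ h1 h2 =>
    obtain ⟨C, hC, h1⟩ := h1
    obtain ⟨D, hD, h2⟩ := h2
    exact ⟨C + D, by positivity, fun δ hδ u => norm_add_le_of_le (h1 δ hδ u) (h2 δ hδ u)⟩
  | mul _ _ h1 h2 =>
    obtain ⟨C, hC, h1⟩ := h1
    obtain ⟨D, hD, h2⟩ := h2
    exact ⟨C * D, by positivity, fun δ hδ u => norm_mul_le_of_le (h1 δ hδ u) (h2 δ hδ u)⟩

theorem IsCoeff.exists_hasDerivAt {P : ℝ → ℝ → ℂ} (hP : IsCoeff P) :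
    ∃ Q, IsCoeff Q ∧ ∀ δ ∈ Set.Icc (0 : ℝ) 0.9, ∀ u, HasDerivAt (P δ) (Q δ u) u := by
  induction hP with
  | const z => exact ⟨_, .const 0, fun _ _ u => hasDerivAt_const u z⟩
  | param => exact ⟨_, .const 0, fun δ _ u => hasDerivAt_const u (δ : ℂ)⟩
  | tanh =>
    refine ⟨_, .mul .sech .sech, fun δ _ u => ?_⟩
    refine (hasDerivAt_tanh u).ofReal_comp.congr_deriv ?_
    push_cast
    ring
  | sech =>
    refine ⟨_, .mul (.const (-1)) (.mul .sech .tanh), fun δ _ u => ?_⟩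
    refine (hasDerivAt_inv_cosh u).ofReal_comp.congr_deriv ?_
    push_cast
    ring
  | inv =>
    refine ⟨_, .mul (.mul .param (.mul .sech .tanh)) (.mul .inv .inv), fun δ hδ u => ?_⟩
    have h := phase_deriv_le hδ u
    have hne : δ * (Real.cosh u)⁻¹ - 1 ≠ 0 := by linarith
    refine ((((hasDerivAt_inv_cosh u).const_mul δ).sub_const 1).inv
      hne).ofReal_comp.congr_deriv ?_
    rw [div_eq_mul_inv, ← inv_pow]
    push_cast
    ring
  | add _ _ h1 h2 =>
    obtain ⟨P', hP', h1⟩ := h1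
    obtain ⟨Q', hQ', h2⟩ := h2
    exact ⟨_, hP'.add hQ', fun δ hδ u => (h1 δ hδ u).add (h2 δ hδ u)⟩
  | mul hP hQ h1 h2 =>
    obtain ⟨P', hP', h1⟩ := h1
    obtain ⟨Q', hQ', h2⟩ := h2
    exact ⟨_, (hP'.mul hQ).add (hP.mul hQ'), fun δ hδ u => (h1 δ hδ u).mul (h2 δ hδ u)⟩

theorem IsCoeff.continuous {P : ℝ → ℝ → ℂ} (hP : IsCoeff P) {δ : ℝ}
    (hδ : δ ∈ Set.Icc (0 : ℝ) 0.9) : Continuous (P δ) := by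
  obtain ⟨Q, _, h⟩ := hP.exists_hasDerivAt
  exact continuous_iff_continuousAt.2 fun u => (h δ hδ u).continuousAt

theorem IsCoeff.norm_integrand_le {P : ℝ → ℝ → ℂ} {α : ℂ} {δ C M : ℝ} (hC : 0 ≤ C)
    (hP : ∀ u, ‖P δ u‖ ≤ C) {f : ℝ → ℂ} (hf : ∀ x, ‖f x‖ ≤ M) (s u : ℝ) :
    ‖sechPow α u * P δ u * f (gd u) * osc s δ u‖ ≤ C * M * ‖sechPow α u‖ := by
  rw [norm_mul, norm_mul, norm_mul, norm_osc, mul_one]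
  calc ‖sechPow α u‖ * ‖P δ u‖ * ‖f (gd u)‖
      ≤ ‖sechPow α u‖ * C * M := by gcongr <;> [exact hP u; exact hf _]
    _ = _ := by ring

theorem IsCoeff.integrable {P : ℝ → ℝ → ℂ} (hP : IsCoeff P) {α : ℂ} (hα : α.re = 1 / 2)
    {δ M : ℝ} (hδ : δ ∈ Set.Icc (0 : ℝ) 0.9) {f : ℝ → ℂ} (hfc : Continuous f)
    (hf : ∀ x, ‖f x‖ ≤ M) (s : ℝ) :
    Integrable fun u => sechPow α u * P δ u * f (gd u) * osc s δ u := by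
  obtain ⟨C, hC, hb⟩ := hP.bounded
  refine integrable_of_norm_le_sechPow hα ?_ (C * M)
    fun u => norm_integrand_le hC (hb δ hδ) hf s u
  exact (((continuous_sechPow α).mul (hP.continuous hδ)).mul (hfc.comp continuous_gd)).mul
    (continuous_osc s δ)

theorem IsCoeff.norm_integral_le {α : ℂ} (hα : α.re = 1 / 2) (N : ℕ) :
    ∀ {P : ℝ → ℝ → ℂ}, IsCoeff P → ∃ C : ℝ, 0 ≤ C ∧
      ∀ δ ∈ Set.Icc (0 : ℝ) 0.9, ∀ s : ℝ, 0 < s → ∀ f : ℝ → ℂ, ContDiff ℝ (⊤ : ℕ∞) f →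
        ∀ M : ℝ, (∀ m ≤ N, ∀ x, ‖iteratedDeriv m f x‖ ≤ M) →
          ‖∫ u, sechPow α u * P δ u * f (gd u) * osc s δ u‖ ≤ C * M / s ^ N := by
  induction N with
  | zero =>
    intro P hP
    obtain ⟨C, hC, hb⟩ := hP.bounded
    refine ⟨C * ∫ u, ‖sechPow α u‖, by positivity, fun δ hδ s hs f hf M hM => ?_⟩
    have hf0 : ∀ x, ‖f x‖ ≤ M := by simpa using hM 0 le_rfl
    refine (norm_integral_le_of_norm_le ((integrable_norm_sechPow hα).const_mul (C * M))
      (Filter.Eventually.of_forall fun u =>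
        norm_integrand_le hC (hb δ hδ) hf0 s u)).trans_eq ?_
    rw [integral_const_mul]
    ring
  | succ N ih =>
    intro P hP
    have hPR := hP.mul .inv
    obtain ⟨Q, hQ, hd⟩ := hPR.exists_hasDerivAt
    have hP1 := (IsCoeff.mul (.mul (.const (-α)) .tanh) hPR).add hQ
    have hP2 := hPR.mul .sech
    obtain ⟨C1, hC1, h1⟩ := ih hP1
    obtain ⟨C2, hC2, h2⟩ := ih hP2
    refine ⟨C1 + C2, by positivity, fun δ hδ s hs f hf M hM => ?_⟩
    have hf' : ContDiff ℝ (⊤ : ℕ∞) (deriv f) := (contDiff_infty_iff_deriv.1 hf).2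
    have hfd : Differentiable ℝ f := (contDiff_infty_iff_deriv.1 hf).1
    have hM' : ∀ m ≤ N, ∀ x, ‖iteratedDeriv m (deriv f) x‖ ≤ M := fun m hm x => by
      rw [← iteratedDeriv_succ']
      exact hM (m + 1) (by omega) x
    have hf0 : ∀ x, ‖f x‖ ≤ M := by simpa using hM 0 (by omega)
    have hf0' : ∀ x, ‖deriv f x‖ ≤ M := by simpa using hM' 0 (by omega)
    have i1 := hP1.integrable hα hδ hf.continuous hf0 s
    have i2 := hP2.integrable hα hδ hf'.continuous hf0' s
    have i0 := hP.integrable hα hδ hf.continuous hf0 s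
    have iH := hPR.integrable hα hδ hf.continuous hf0 s
    have key := integral_eq_zero_of_hasDerivAt_of_integrable (fun u => ?_)
      ((i1.add i2).add (i0.const_mul (Complex.I * s))) iH
    · rw [integral_add' (i1.add i2) (i0.const_mul _), integral_const_mul,
        integral_add' i1 i2] at key
      have b1 := h1 δ hδ s hs f hf M fun m hm => hM m (by omega)
      have b2 := h2 δ hδ s hs (deriv f) hf' M hM'
      have key2 := congrArg norm (eq_neg_of_add_eq_zero_right key)
      rw [norm_neg, norm_mul, norm_mul, Complex.norm_I, one_mul, Complex.norm_real,
        Real.norm_of_nonneg hs.le] at key2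
      have b3 := key2.trans_le (norm_add_le_of_le b1 b2)
      rw [pow_succ, ← div_div, le_div_iff₀ hs, mul_comm]
      refine b3.trans_eq ?_
      ring
    · have hv := phase_deriv_le hδ u
      have hne : ((δ * (Real.cosh u)⁻¹ - 1 : ℝ) : ℂ) ≠ 0 :=
        Complex.ofReal_ne_zero.2 (by linarith)
      have hD := (((hasDerivAt_sechPow α u).mul (hd δ hδ u)).mul
        ((hfd (gd u)).hasDerivAt.scomp u (hasDerivAt_gd u))).mul (hasDerivAt_osc s δ u)
      refine hD.congr_deriv ?_
      simp only [Pi.add_apply, Pi.mul_apply, Function.comp_apply, Complex.real_smul,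
        Complex.ofReal_inv (δ * (Real.cosh u)⁻¹ - 1)]
      generalize ((δ * (Real.cosh u)⁻¹ - 1 : ℝ) : ℂ) = v at hne ⊢
      field_simp

/-- Majorant for the stationary region of the phase `δ * gd u - u`. -/
noncomputable def statKer (s δ u : ℝ) : ℝ :=
  |Real.tanh u| * (δ * (Real.cosh u)⁻¹) / (1 + s * (δ * (Real.cosh u)⁻¹ - 1) ^ 2)

theorem one_add_mul_sq_pos {s : ℝ} (hs : 0 < s) (v : ℝ) : 0 < 1 + s * v ^ 2 := by positivity

theorem continuous_inv_one_add {s : ℝ} (hs : 0 < s) (δ : ℝ) :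
    Continuous fun u => (1 + s * (δ * (Real.cosh u)⁻¹ - 1) ^ 2)⁻¹ :=
  Continuous.inv₀ (by have := continuous_inv_cosh; fun_prop)
    fun u => (one_add_mul_sq_pos hs _).ne'

theorem continuous_statKer {s : ℝ} (hs : 0 < s) (δ : ℝ) : Continuous (statKer s δ) :=
  (continuous_tanh.abs.mul (continuous_const.mul continuous_inv_cosh)).mul
    (continuous_inv_one_add hs δ)

theorem statKer_nonneg {s δ : ℝ} (hs : 0 < s) (hδ : 0 ≤ δ) (u : ℝ) : 0 ≤ statKer s δ u := by
  have := inv_cosh_pos u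
  unfold statKer
  positivity

theorem integrable_statKer {s δ : ℝ} (hs : 0 < s) (hδ : 0 ≤ δ) : Integrable (statKer s δ) := by
  have hα : ((1 / 2 : ℝ) : ℂ).re = 1 / 2 := Complex.ofReal_re _
  refine integrable_of_norm_le_sechPow hα (continuous_statKer hs δ) δ fun u => ?_
  rw [Real.norm_of_nonneg (statKer_nonneg hs hδ u)]
  have h1 := inv_cosh_le_norm_sechPow hα u
  have h2 := (inv_cosh_pos u).le
  have h3 : (1 : ℝ) ≤ 1 + s * (δ * (Real.cosh u)⁻¹ - 1) ^ 2 := by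
    have : 0 ≤ s * (δ * (Real.cosh u)⁻¹ - 1) ^ 2 := by positivity
    linarith
  calc statKer s δ u ≤ |Real.tanh u| * (δ * (Real.cosh u)⁻¹) := div_le_self (by positivity) h3
    _ ≤ 1 * (δ * (Real.cosh u)⁻¹) := by gcongr; exact (Real.abs_tanh_lt_one u).le
    _ ≤ _ := by rw [one_mul]; gcongr

theorem tendsto_inv_cosh : Filter.Tendsto (fun u => (Real.cosh u)⁻¹) Filter.atTop (nhds 0) := by
  refine Filter.Tendsto.inv_tendsto_atTop ?_
  refine Filter.tendsto_atTop_mono (fun u => ?_)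
    (Real.tendsto_exp_atTop.const_mul_atTop (r := 1 / 2) (by norm_num))
  have h := exp_abs_le_two_mul_cosh u
  have h2 := Real.exp_le_exp.2 (le_abs_self u)
  linarith

theorem integral_statKer_le {s δ : ℝ} (hs : 0 < s) (hδ : 0 ≤ δ) :
    ∫ u, statKer s δ u ≤ 2 * π / √s := by
  have hr := Real.sqrt_pos.2 hs
  have hr2 := Real.sq_sqrt hs.le
  have habs : ∀ u, statKer s δ u = (fun x => Real.tanh x * (δ * (Real.cosh x)⁻¹) /
      (1 + s * (δ * (Real.cosh x)⁻¹ - 1) ^ 2)) |u| := by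
    intro u
    have ht : Real.tanh |u| = |Real.tanh u| := by
      rw [Real.tanh_eq_sinh_div_cosh, Real.tanh_eq_sinh_div_cosh, abs_div, Real.abs_sinh,
        Real.cosh_abs, abs_of_pos (Real.cosh_pos u)]
    simp only [statKer, Real.cosh_abs, ht]
  have hlim := ((Real.continuous_arctan.tendsto _).comp
    (((tendsto_inv_cosh.const_mul δ).sub_const 1).const_mul √s)).neg.div_const √s
  refine ((integral_congr_ae (Filter.Eventually.of_forall habs)).trans (integral_comp_abs
    (f := fun x => Real.tanh x * (δ * (Real.cosh x)⁻¹) /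
      (1 + s * (δ * (Real.cosh x)⁻¹ - 1) ^ 2)))).trans_le ?_
  rw [integral_Ioi_of_hasDerivAt_of_nonneg' (fun u _ => ?_) (fun u hu => ?_) hlim]
  · have h1 := Real.neg_pi_div_two_lt_arctan (√s * (δ * 0 - 1))
    have h2 := Real.arctan_lt_pi_div_two (√s * (δ * (Real.cosh 0)⁻¹ - 1))
    rw [← sub_div, mul_div_assoc]
    gcongr
    simp only [Function.comp_apply]
    linarith
  · refine (((((hasDerivAt_inv_cosh u).const_mul δ).sub_const
      1).const_mul √s).arctan.neg.div_const √s).congr_deriv ?_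
    have := one_add_mul_sq_pos hs (δ * (Real.cosh u)⁻¹ - 1)
    rw [mul_pow, hr2]
    generalize δ * (Real.cosh u)⁻¹ - 1 = v at *
    field_simp
  · have := inv_cosh_pos u
    have h0 : 0 ≤ Real.tanh u := by
      rw [Real.tanh_eq_sinh_div_cosh]
      exact div_nonneg (Real.sinh_nonneg_iff.2 (le_of_lt hu)) (Real.cosh_pos u).le
    positivity

theorem abs_div_one_add_le {s : ℝ} (hs : 0 < s) (v : ℝ) :
    |v| / (1 + s * v ^ 2) ≤ 1 / (2 * √s) := by
  have hr := Real.sqrt_pos.2 hs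
  have hr2 := Real.sq_sqrt hs.le
  rw [div_le_div_iff₀ (one_add_mul_sq_pos hs v) (by positivity), ← sq_abs v]
  nth_rw 2 [← hr2]
  nlinarith [sq_nonneg (√s * |v| - 1)]

theorem hasDerivAt_phase_quot {s : ℝ} (hs : 0 < s) (δ u : ℝ) :
    HasDerivAt (fun x => (δ * (Real.cosh x)⁻¹ - 1) / (1 + s * (δ * (Real.cosh x)⁻¹ - 1) ^ 2))
      (-(δ * (Real.cosh u)⁻¹ * Real.tanh u) * (1 - s * (δ * (Real.cosh u)⁻¹ - 1) ^ 2) /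
        (1 + s * (δ * (Real.cosh u)⁻¹ - 1) ^ 2) ^ 2) u := by
  have hv := ((hasDerivAt_inv_cosh u).const_mul δ).sub_const 1
  have hne := (one_add_mul_sq_pos hs (δ * (Real.cosh u)⁻¹ - 1)).ne'
  refine (hv.div (((hv.pow 2).const_mul s).const_add 1) hne).congr_deriv ?_
  simp only [Pi.pow_apply]
  congr 1
  push_cast
  ring

theorem abs_deriv_phase_quot_le {s δ : ℝ} (hs : 0 < s) (hδ : 0 ≤ δ) (u : ℝ) :
    |-(δ * (Real.cosh u)⁻¹ * Real.tanh u) * (1 - s * (δ * (Real.cosh u)⁻¹ - 1) ^ 2) /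
        (1 + s * (δ * (Real.cosh u)⁻¹ - 1) ^ 2) ^ 2| ≤ statKer s δ u := by
  have hD := one_add_mul_sq_pos hs (δ * (Real.cosh u)⁻¹ - 1)
  have hc := inv_cosh_pos u
  unfold statKer
  have h0 : 0 ≤ s * (δ * (Real.cosh u)⁻¹ - 1) ^ 2 := by positivity
  generalize s * (δ * (Real.cosh u)⁻¹ - 1) ^ 2 = w at *
  rw [abs_div, abs_mul, abs_neg, abs_mul, abs_of_nonneg (by positivity : 0 ≤ δ * (Real.cosh u)⁻¹),
    abs_of_pos (by positivity : 0 < (1 + w) ^ 2), div_le_div_iff₀ (by positivity) hD]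
  have h1 : |1 - w| ≤ 1 + w := abs_le.2 ⟨by linarith, by linarith⟩
  calc δ * (Real.cosh u)⁻¹ * |Real.tanh u| * |1 - w| * (1 + w)
      ≤ δ * (Real.cosh u)⁻¹ * |Real.tanh u| * (1 + w) * (1 + w) := by gcongr
    _ = _ := by ring

theorem div_one_add_le {s δ κ a u : ℝ} (hs : 0 < s) (hδ : 0 ≤ δ) (hκ : 0 < κ) (ha : 0 ≤ a)
    (h : κ * a ≤ |Real.tanh u| * a) :
    a / (1 + s * (δ * (Real.cosh u)⁻¹ - 1) ^ 2) ≤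
      a * statKer s δ u / κ + a * (1 / (2 * √s)) := by
  have hD := one_add_mul_sq_pos hs (δ * (Real.cosh u)⁻¹ - 1)
  have hq := abs_div_one_add_le hs (δ * (Real.cosh u)⁻¹ - 1)
  have hc := inv_cosh_pos u
  unfold statKer
  set v := δ * (Real.cosh u)⁻¹ - 1 with hv
  have hv1 : δ * (Real.cosh u)⁻¹ = v + 1 := by rw [hv]; ring
  have hv0 : 0 ≤ v + 1 := by rw [← hv1]; positivity
  rw [hv1]
  have h1 : a * 1 ≤ a * (v + 1) + a * |v| := by
    rw [← mul_add]
    gcongr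
    linarith [neg_abs_le v]
  have h2 : a * (v + 1) ≤ a * |Real.tanh u| * (v + 1) / κ := by
    rw [le_div_iff₀ hκ]
    nlinarith
  calc a / (1 + s * v ^ 2)
      ≤ (a * |Real.tanh u| * (v + 1) / κ + a * |v|) / (1 + s * v ^ 2) := by
        gcongr
        linarith
    _ = a * (|Real.tanh u| * (v + 1) / (1 + s * v ^ 2)) / κ + a * (|v| / (1 + s * v ^ 2)) := by
        field_simp
    _ ≤ _ := by gcongr

theorem norm_integral_osc_le {α : ℂ} (hα : α.re = 1 / 2) {κ s δ M : ℝ} (hκ : 0 < κ)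
    (hs : 0 < s) (hδ : 0 ≤ δ) {f : ℝ → ℂ} (hf : ContDiff ℝ (⊤ : ℕ∞) f)
    (hM0 : ∀ x, ‖f x‖ ≤ M) (hM1 : ∀ x, ‖deriv f x‖ ≤ M)
    (hvan : ∀ u, κ * ‖f (gd u)‖ ≤ |Real.tanh u| * ‖f (gd u)‖) :
    ‖∫ u, sechPow α u * f (gd u) * osc s δ u‖ ≤
      M * ((1 + 1 / κ) * (2 * π) + (‖α‖ + 2) * (∫ u, ‖sechPow α u‖)) / √s := by
  have hr := Real.sqrt_pos.2 hs
  have hf' : ContDiff ℝ (⊤ : ℕ∞) (deriv f) := (contDiff_infty_iff_deriv.1 hf).2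
  have hfd : Differentiable ℝ f := (contDiff_infty_iff_deriv.1 hf).1
  have hM : 0 ≤ M := (norm_nonneg _).trans (hM0 0)
  have c1 := continuous_sechPow α
  have c2 := hf.continuous.comp continuous_gd
  have c3 := hf'.continuous.comp continuous_gd
  have c4 := continuous_osc s δ
  have c5 := continuous_inv_cosh
  have c6 := continuous_tanh
  have c7 := continuous_inv_one_add hs δ
  simp only [Function.comp_def] at c2 c3
  set A : ℝ → ℂ := fun u => sechPow α u * f (gd u) with hA
  set A' : ℝ → ℂ := fun u => -α * (Real.tanh u : ℂ) * sechPow α u * f (gd u) +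
    sechPow α u * (((Real.cosh u)⁻¹ : ℝ) * deriv f (gd u)) with hA'
  set v : ℝ → ℝ := fun u => δ * (Real.cosh u)⁻¹ - 1 with hv
  set D : ℝ → ℝ := fun u => 1 + s * v u ^ 2 with hD
  set g' : ℝ → ℝ := fun u => -(δ * (Real.cosh u)⁻¹ * Real.tanh u) * (1 - s * v u ^ 2) / D u ^ 2
    with hg'
  have hDpos : ∀ u, 0 < D u := fun u => one_add_mul_sq_pos hs (v u)
  have hAd : ∀ u, HasDerivAt A (A' u) u := fun u =>
    ((hasDerivAt_sechPow α u).mul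
      ((hfd (gd u)).hasDerivAt.scomp u (hasDerivAt_gd u))).congr_deriv (by
        simp only [Function.comp_apply, Complex.real_smul, hA'])
  have cA : Continuous A := c1.mul c2
  have cA' : Continuous A' :=
    (((continuous_const.mul (Complex.continuous_ofReal.comp c6)).mul c1).mul c2).add
      (c1.mul ((Complex.continuous_ofReal.comp c5).mul c3))
  have cv : Continuous v := by fun_prop
  have cg' : Continuous g' := by
    refine Continuous.div (by fun_prop) (by fun_prop) fun u => (pow_pos (hDpos u) 2).ne'
  have hAn : ∀ u, ‖A u‖ ≤ M * ‖sechPow α u‖ := fun u => by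
    rw [hA, norm_mul, mul_comm]
    gcongr
    exact hM0 _
  have hAn1 : ∀ u, ‖A u‖ ≤ M := fun u => (hAn u).trans
    (mul_le_of_le_one_right hM (norm_sechPow_le_one hα u))
  have hA'n : ∀ u, ‖A' u‖ ≤ (‖α‖ + 1) * M * ‖sechPow α u‖ := fun u => by
    have e1 : ‖-α * (Real.tanh u : ℂ) * sechPow α u * f (gd u)‖ ≤
        ‖α‖ * 1 * ‖sechPow α u‖ * M := by
      rw [norm_mul, norm_mul, norm_mul, norm_neg, Complex.norm_real]
      gcongr
      · exact (Real.abs_tanh_lt_one u).le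
      · exact hM0 _
    have e2 : ‖sechPow α u * (((Real.cosh u)⁻¹ : ℝ) * deriv f (gd u))‖ ≤
        ‖sechPow α u‖ * (1 * M) := by
      rw [norm_mul, norm_mul, Complex.norm_real, Real.norm_of_nonneg (inv_cosh_pos u).le]
      gcongr
      · exact inv_cosh_le_one u
      · exact hM1 _
    exact (norm_add_le_of_le e1 e2).trans_eq (by ring)
  set X : ℝ → ℂ := fun u => A' u * ((v u / D u : ℝ) : ℂ) * osc s δ u +
    A u * (g' u : ℂ) * osc s δ u + -Complex.I * (A u * ((D u)⁻¹ : ℝ) * osc s δ u) with hX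
  set B : ℝ → ℝ := fun u => M * (1 + 1 / κ) * statKer s δ u +
    M * (‖α‖ + 2) / √s * ‖sechPow α u‖ with hB
  have hXB : ∀ u, ‖X u‖ ≤ B u := by
    intro u
    have hq := abs_div_one_add_le hs (v u)
    have b1 : ‖A' u * ((v u / D u : ℝ) : ℂ) * osc s δ u‖ ≤
        (‖α‖ + 1) * M * ‖sechPow α u‖ * (1 / (2 * √s)) := by
      rw [norm_mul, norm_osc, mul_one, norm_mul, Complex.norm_real, Real.norm_eq_abs, abs_div,
        abs_of_pos (hDpos u)]
      gcongr
      exact hA'n u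
    have b2 : ‖A u * (g' u : ℂ) * osc s δ u‖ ≤ M * statKer s δ u := by
      rw [norm_mul, norm_osc, mul_one, norm_mul, Complex.norm_real]
      gcongr
      · exact hAn1 u
      · exact abs_deriv_phase_quot_le hs hδ u
    have b3 : ‖-Complex.I * (A u * ((D u)⁻¹ : ℝ) * osc s δ u)‖ ≤
        M * statKer s δ u / κ + M * ‖sechPow α u‖ * (1 / (2 * √s)) := by
      have hk : κ * ‖A u‖ ≤ |Real.tanh u| * ‖A u‖ := by
        rw [hA, norm_mul, mul_left_comm, mul_left_comm (|Real.tanh u|)]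
        gcongr ?_ * ?_
        exact hvan u
      have h := div_one_add_le hs hδ hκ (norm_nonneg (A u)) hk
      have hK := statKer_nonneg hs hδ u
      rw [norm_mul, norm_neg, Complex.norm_I, one_mul, norm_mul, norm_osc, mul_one, norm_mul,
        Complex.norm_real, Real.norm_of_nonneg (inv_pos.2 (hDpos u)).le, ← div_eq_mul_inv]
      refine h.trans ?_
      gcongr
      · exact hAn1 u
      · exact hAn u
    refine (norm_add₃_le.trans (add_le_add_three b1 b2 b3)).trans ?_
    have hW := norm_nonneg (sechPow α u)
    have e : B u - ((‖α‖ + 1) * M * ‖sechPow α u‖ * (1 / (2 * √s)) + M * statKer s δ u +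
        (M * statKer s δ u / κ + M * ‖sechPow α u‖ * (1 / (2 * √s)))) =
        (‖α‖ + 2) * M * ‖sechPow α u‖ * (1 / (2 * √s)) := by
      rw [hB]
      field_simp
      ring
    have : 0 ≤ (‖α‖ + 2) * M * ‖sechPow α u‖ * (1 / (2 * √s)) := by positivity
    linarith
  have iB : Integrable B := ((integrable_statKer hs hδ).const_mul _).add
    ((integrable_norm_sechPow hα).const_mul _)
  have cvD : Continuous fun u => v u / D u := cv.mul c7
  have cX : Continuous X := by fun_prop
  have iX : Integrable X := iB.mono' cX.aestronglyMeasurable (Filter.Eventually.of_forall hXB)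
  have iA : Integrable fun u => A u * osc s δ u := by
    refine integrable_of_norm_le_sechPow hα (cA.mul c4) M fun u => ?_
    rw [norm_mul, norm_osc, mul_one]
    exact hAn u
  have iH : Integrable fun u => A u * ((v u / D u : ℝ) : ℂ) * osc s δ u := by
    refine integrable_of_norm_le_sechPow hα
      ((cA.mul (Complex.continuous_ofReal.comp cvD)).mul c4) (M * (1 / (2 * √s))) fun u => ?_
    rw [norm_mul, norm_osc, mul_one, norm_mul, Complex.norm_real, Real.norm_eq_abs, abs_div,
        abs_of_pos (hDpos u), mul_right_comm]
    exact mul_le_mul (hAn u) (abs_div_one_add_le hs (v u))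
      (div_nonneg (abs_nonneg _) (hDpos u).le) (by positivity)
  have key := integral_eq_zero_of_hasDerivAt_of_integrable (fun u => ?_)
    (iX.add (iA.const_mul Complex.I)) iH
  · rw [integral_add' iX (iA.const_mul _), integral_const_mul] at key
    have key2 := congrArg norm (eq_neg_of_add_eq_zero_right key)
    rw [norm_neg, norm_mul, Complex.norm_I, one_mul] at key2
    rw [key2]
    refine (norm_integral_le_of_norm_le iB (Filter.Eventually.of_forall hXB)).trans ?_
    rw [hB, integral_add ((integrable_statKer hs hδ).const_mul _)
      ((integrable_norm_sechPow hα).const_mul _), integral_const_mul, integral_const_mul]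
    calc M * (1 + 1 / κ) * (∫ u, statKer s δ u) +
          M * (‖α‖ + 2) / √s * ∫ u, ‖sechPow α u‖
        ≤ M * (1 + 1 / κ) * (2 * π / √s) + M * (‖α‖ + 2) / √s * ∫ u, ‖sechPow α u‖ := by
          gcongr
          exact integral_statKer_le hs hδ
      _ = _ := by ring
  · have hne : (D u : ℂ) ≠ 0 := Complex.ofReal_ne_zero.2 (hDpos u).ne'
    refine (((hAd u).mul (hasDerivAt_phase_quot hs δ u).ofReal_comp).mul
      (hasDerivAt_osc s δ u)).congr_deriv ?_
    have hDv : (D u : ℂ) = 1 + s * (v u : ℂ) ^ 2 := by rw [hD]; push_cast; ring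
    have hI : ((v u / D u : ℝ) : ℂ) * (s * (v u : ℂ)) = 1 - ((D u)⁻¹ : ℝ) := by
      push_cast
      field_simp
      rw [hDv]
      ring
    change (A' u * ((v u / D u : ℝ) : ℂ) + A u * (g' u : ℂ)) * osc s δ u +
      A u * ((v u / D u : ℝ) : ℂ) * (Complex.I * s * (v u : ℂ) * osc s δ u) =
      X u + Complex.I * (A u * osc s δ u)
    rw [hX]
    linear_combination A u * Complex.I * osc s δ u * hI

theorem gd_mem_Ioo (u : ℝ) : gd u ∈ Set.Ioo 0 π := by
  have h1 := Real.arctan_pos.2 (Real.exp_pos u)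
  have h2 := Real.arctan_lt_pi_div_two (Real.exp u)
  constructor <;> unfold gd <;> linarith

theorem image_gd : gd '' Set.univ = Set.Ioo 0 π := by
  ext c
  constructor
  · rintro ⟨u, -, rfl⟩
    exact gd_mem_Ioo u
  · rintro ⟨h0, h1⟩
    have ht := Real.tan_pos_of_pos_of_lt_pi_div_two (x := c / 2) (by linarith) (by linarith)
    refine ⟨Real.log (Real.tan (c / 2)), trivial, ?_⟩
    rw [gd, Real.exp_log ht, Real.arctan_tan (by linarith) (by linarith)]
    ring

theorem injective_gd : Function.Injective gd := fun _ _ h =>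
  Real.exp_injective (Real.arctan_injective (mul_left_cancel₀ two_ne_zero h))

theorem sin_half_gd (u : ℝ) : Real.sin (gd u / 2) = Real.exp u / √(1 + Real.exp u ^ 2) := by
  rw [gd, mul_div_cancel_left₀ _ two_ne_zero, Real.sin_arctan]

theorem cos_half_gd (u : ℝ) : Real.cos (gd u / 2) = 1 / √(1 + Real.exp u ^ 2) := by
  rw [gd, mul_div_cancel_left₀ _ two_ne_zero, Real.cos_arctan]

theorem sin_gd (u : ℝ) : Real.sin (gd u) = (Real.cosh u)⁻¹ := by
  have h : gd u = 2 * (gd u / 2) := by ring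
  have hp : 0 < 1 + Real.exp u ^ 2 := by positivity
  have hc := (Real.cosh_pos u).ne'
  have hs := Real.sq_sqrt hp.le
  have hs0 := (Real.sqrt_pos.2 hp).ne'
  rw [h, Real.sin_two_mul, sin_half_gd, cos_half_gd]
  field_simp
  rw [hs, one_add_exp_sq]

theorem cos_gd (u : ℝ) : Real.cos (gd u) = -Real.tanh u := by
  have h : gd u = 2 * (gd u / 2) := by ring
  have hp : 0 < 1 + Real.exp u ^ 2 := by positivity
  rw [h, Real.cos_two_mul, cos_half_gd, div_pow, Real.sq_sqrt hp.le, Real.tanh_eq_sinh_div_cosh,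
    one_add_exp_sq]
  have hc := Real.cosh_pos u
  have he := Real.exp_pos u
  field_simp
  rw [← Real.cosh_add_sinh]
  have := Real.cosh_sq u
  nlinarith

theorem log_cos_sub_log_sin_half_gd (u : ℝ) :
    Real.log |Real.cos (gd u / 2)| - Real.log |Real.sin (gd u / 2)| = -u := by
  have hp : 0 < √(1 + Real.exp u ^ 2) := Real.sqrt_pos.2 (by positivity)
  rw [Real.log_abs, Real.log_abs, cos_half_gd, sin_half_gd,
    Real.log_div one_ne_zero hp.ne', Real.log_div (Real.exp_pos u).ne' hp.ne', Real.log_exp,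
    Real.log_one]
  ring

theorem Gfun_eq_integral (τ τ' : ℂ) (n : ℤ) {t : ℝ} (ht : t ≠ 0) (φ : ℝ → ℂ) :
    Gfun τ τ' (Complex.I * (t : ℂ)) n φ =
      2 * ∫ u, sechPow ((1 - τ - τ') / 2) u * φ (gd u) * osc (t / 2) (2 * n / t) u := by
  rw [Gfun, intervalIntegral.integral_of_le Real.pi_pos.le, integral_Ioc_eq_integral_Ioo,
    ← image_gd, integral_image_eq_integral_abs_deriv_smul MeasurableSet.univ
      (fun u _ => (hasDerivAt_gd u).hasDerivWithinAt) injective_gd.injOn, setIntegral_univ]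
  congr 2
  funext u
  have hc : Complex.exp ((Real.log (Real.cosh u)⁻¹ : ℝ) : ℂ) = (((Real.cosh u)⁻¹ : ℝ) : ℂ) := by
    rw [← Complex.ofReal_exp, Real.exp_log (inv_cosh_pos u)]
  have hl := log_cos_sub_log_sin_half_gd u
  have hl2 : (Real.log |Real.cos (gd u / 2)| : ℂ) =
      (Real.log |Real.sin (gd u / 2)| : ℂ) - (u : ℂ) := by
    rw [← Complex.ofReal_sub]
    congr 1
    linarith
  rw [abs_of_pos (inv_cosh_pos u), Complex.real_smul, ← hc]
  simp only [kfun, pw, sechPow, osc]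
  rw [hl2, sin_gd, abs_of_pos (inv_cosh_pos u), Real.log_inv]
  rw [show ∀ a b c d e f : ℂ, a * (b * c * d * e * f) = (a * b * c * d * e) * f by intros; ring,
    mul_right_comm (Complex.exp (-((1 - τ - τ') / 2) * _))]
  simp only [← Complex.exp_add]
  congr 2
  have ht' : (t : ℂ) ≠ 0 := Complex.ofReal_ne_zero.2 ht
  push_cast
  field_simp
  ring

theorem mul_norm_le_abs_tanh_mul {η : ℝ} {φ : ℝ → ℂ}
    (h : ∀ c ∈ Set.Icc (0 : ℝ) π, |c - π / 2| < η → φ c = 0) (u : ℝ) :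
    2 / π * η * ‖φ (gd u)‖ ≤ |Real.tanh u| * ‖φ (gd u)‖ := by
  have hg := gd_mem_Ioo u
  by_cases hc : |gd u - π / 2| < η
  · rw [h _ ⟨hg.1.le, hg.2.le⟩ hc]
    simp
  · gcongr
    have h1 := Real.mul_abs_le_abs_sin (x := gd u - π / 2)
      (abs_le.2 ⟨by linarith [hg.1], by linarith [hg.2]⟩)
    rw [Real.sin_sub_pi_div_two, cos_gd, neg_neg] at h1
    refine le_trans ?_ h1
    have := Real.pi_pos
    gcongr
    exact not_lt.1 hc

/-- Bounds for `G_{it,n}(φ)` when `φ` vanishes near `c₀ = π/2`: with `δ = 2n/t`,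
`|G_{it,n}(φ)| ≤ C' ‖φ‖_{C²} t^{-1/2}` if `δ > 0.9`, and
`|G_{it,n}(φ)| ≤ C'_N ‖φ‖_{C^N} t^{-N}` for every `N > 0` if `0 ≤ δ ≤ 0.9`. -/
theorem stmt_14 (τ τ' : ℂ) (hτ : τ.re = 0) (hτ' : τ'.re = 0) (η : ℝ) (hη : 0 < η) :
    ∃ C' : ℝ, 0 < C' ∧
      (∀ n : ℤ, 0 ≤ n → Even n →
        ∀ t : ℝ, 2 * (‖τ‖ + ‖τ'‖) + 1 ≤ t →
          ∀ φ : ℝ → ℂ, ContDiff ℝ (⊤ : ℕ∞) φ → (∀ x : ℝ, φ (x + π) = φ x) →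
            (∀ c ∈ Set.Icc (0 : ℝ) π, |c - π / 2| < η → φ c = 0) →
            0.9 < 2 * (n : ℝ) / t →
              ‖Gfun τ τ' (Complex.I * (t : ℂ)) n φ‖ ≤
                C' * Cnorm 2 φ * t ^ (-(1 / 2) : ℝ)) ∧
      ∀ N : ℕ, 0 < N → ∃ CN : ℝ, 0 < CN ∧
        ∀ n : ℤ, 0 ≤ n → Even n →
          ∀ t : ℝ, 2 * (‖τ‖ + ‖τ'‖) + 1 ≤ t →
            ∀ φ : ℝ → ℂ, ContDiff ℝ (⊤ : ℕ∞) φ → (∀ x : ℝ, φ (x + π) = φ x) →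
              (∀ c ∈ Set.Icc (0 : ℝ) π, |c - π / 2| < η → φ c = 0) →
              2 * (n : ℝ) / t ≤ 0.9 →
                ‖Gfun τ τ' (Complex.I * (t : ℂ)) n φ‖ ≤
                  CN * Cnorm N φ * t ^ (-(N : ℝ)) := by
  have hα : ((1 - τ - τ') / 2).re = 1 / 2 := by
    rw [Complex.div_ofNat_re, Complex.sub_re, Complex.sub_re, hτ, hτ']
    norm_num
  have hκ : 0 < 2 / π * η := by have := Real.pi_pos; positivity
  have ht0 : ∀ t : ℝ, 2 * (‖τ‖ + ‖τ'‖) + 1 ≤ t → 0 < t := fun t ht => by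
    linarith [norm_nonneg τ, norm_nonneg τ']
  have hbound : ∀ {φ : ℝ → ℂ} (N : ℕ), ContDiff ℝ (⊤ : ℕ∞) φ → (∀ x : ℝ, φ (x + π) = φ x) →
      ∀ m ≤ N, ∀ x, ‖iteratedDeriv m φ x‖ ≤ Cnorm N φ :=
    fun N h1 h2 m hm x => iteratedDeriv_norm_le_Cnorm h1 h2 hm x
  set K : ℝ := (1 + 1 / (2 / π * η)) * (2 * π) +
    (‖(1 - τ - τ') / 2‖ + 2) * (∫ u, ‖sechPow ((1 - τ - τ') / 2) u‖) with hK
  have hKpos : 0 < K := by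
    have := Real.pi_pos
    have h2 : 0 ≤ ∫ u, ‖sechPow ((1 - τ - τ') / 2) u‖ := by positivity
    positivity
  refine ⟨2 * (K * √2), by positivity, ?_, ?_⟩
  · intro n hn _ t ht φ hφ hper hvan _
    have htpos := ht0 t ht
    have hδ : 0 ≤ 2 * (n : ℝ) / t := by
      have : (0 : ℝ) ≤ n := by exact_mod_cast hn
      positivity
    have hM := hbound 2 hφ hper
    have h := norm_integral_osc_le hα hκ (half_pos htpos) hδ hφ
      (by simpa using hM 0 (by norm_num)) (by simpa using hM 1 (by norm_num))
      (mul_norm_le_abs_tanh_mul hvan)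
    rw [Gfun_eq_integral τ τ' n htpos.ne', norm_mul, Complex.norm_ofNat]
    refine (mul_le_mul_of_nonneg_left h zero_le_two).trans_eq ?_
    rw [Real.rpow_neg htpos.le, ← Real.sqrt_eq_rpow, Real.sqrt_div' _ zero_le_two, ← hK]
    have := Real.sqrt_pos.2 htpos
    field_simp
  · intro N _
    obtain ⟨C, hC, h⟩ := IsCoeff.norm_integral_le hα N (.const 1)
    refine ⟨2 * (C * 2 ^ N) + 1, by positivity, fun n hn _ t ht φ hφ hper _ hδ' => ?_⟩
    have htpos := ht0 t ht
    have hδ : 0 ≤ 2 * (n : ℝ) / t := by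
      have : (0 : ℝ) ≤ n := by exact_mod_cast hn
      positivity
    have hM := hbound N hφ hper
    have h1 := h _ ⟨hδ, hδ'⟩ _ (half_pos htpos) φ hφ _ hM
    have hM0 : 0 ≤ Cnorm N φ := (norm_nonneg _).trans (hM 0 (Nat.zero_le N) 0)
    simp only [mul_one] at h1
    rw [Gfun_eq_integral τ τ' n htpos.ne', norm_mul, Complex.norm_ofNat, Real.rpow_neg htpos.le,
      Real.rpow_natCast]
    refine (mul_le_mul_of_nonneg_left h1 zero_le_two).trans ?_
    calc 2 * (C * Cnorm N φ / (t / 2) ^ N) = 2 * (C * 2 ^ N) * Cnorm N φ * (t ^ N)⁻¹ := by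
          rw [div_pow]
          field_simp
      _ ≤ (2 * (C * 2 ^ N) + 1) * Cnorm N φ * (t ^ N)⁻¹ := by
          gcongr
          linarith
end
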